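/- arXiv:1511.02374 — 2 statements merged into one kernel-verified Lean document; each statement's English description precedes it below -/
import Mathlib

section
/- For every prime p and integers a > b ≥ 0 with a > 1, every primitive S-ring over the abelian group Z_{p^a} × Z_{p^b} has rank 2, i.e., its only basic sets are {e} and G \ {e}. -/
open scoped BigOperators Pointwise Classical

noncomputable section

/-- The group-ring element `X̄ = Σ_{x∈X} x` in `ℤG`. -/
def ind {G : Type*} [Group G] (X : Finset G) : MonoidAlgebra ℤ G :=
  ∑ x ∈ X, MonoidAlgebra.single x 1

/-- The ℤ-span of the class sums of the members of `S`. -/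
def spanA {G : Type*} [Group G] (S : Finset (Finset G)) :
    Submodule ℤ (MonoidAlgebra ℤ G) :=
  Submodule.span ℤ (ind '' (S : Set (Finset G)))

/-- `S` is the partition of basic sets of an S-ring over `G`. -/
structure IsSRing {G : Type*} [Group G] (S : Finset (Finset G)) : Prop where
  cover : ∀ g : G, ∃ X ∈ S, g ∈ X
  disj : ∀ X ∈ S, ∀ Y ∈ S, X ≠ Y → Disjoint X Y
  nonempty : ∀ X ∈ S, X.Nonempty
  one_mem : ({1} : Finset G) ∈ S
  inv_mem : ∀ X ∈ S, X.image (·⁻¹) ∈ S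
  mul_closed : ∀ a ∈ spanA S, ∀ b ∈ spanA S, a * b ∈ spanA S

/-- `X` is an `A`-set: its class sum lies in the span of the basic class sums. -/
def IsASet {G : Type*} [Group G] (S : Finset (Finset G)) (X : Finset G) : Prop :=
  ind X ∈ spanA S

/-- The finset underlying a subgroup of a finite group. -/
def subgroupFinset {G : Type*} [Group G] [Fintype G] (H : Subgroup G) : Finset G :=
  Finset.univ.filter (· ∈ H)

/-- `H` is an `A`-subgroup. -/
def IsASubgroup {G : Type*} [Group G] [Fintype G] (S : Finset (Finset G))
    (H : Subgroup G) : Prop :=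
  IsASet S (subgroupFinset H)

/-- The radical `rad(X) = {g : gX = Xg = X}` as a subgroup. -/
def radSubgroup {G : Type*} [Group G] (X : Finset G) : Subgroup G where
  carrier := {g : G | X.image (g * ·) = X ∧ X.image (· * g) = X}
  one_mem' := by
    constructor <;> · simp only [one_mul, mul_one]; exact Finset.image_id
  mul_mem' := by
    rintro a b ⟨ha1, ha2⟩ ⟨hb1, hb2⟩
    constructor
    · have : X.image (a * b * ·) = (X.image (b * ·)).image (a * ·) := by
        rw [Finset.image_image]
        exact Finset.image_congr (fun x _ => by simp [mul_assoc])
      rw [this, hb1, ha1]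
    · have : X.image (· * (a * b)) = (X.image (· * a)).image (· * b) := by
        rw [Finset.image_image]
        exact Finset.image_congr (fun x _ => by simp [mul_assoc])
      rw [this, ha2, hb2]
  inv_mem' := by
    rintro a ⟨ha1, ha2⟩
    constructor
    · have := congrArg (Finset.image (a⁻¹ * ·)) ha1
      rw [Finset.image_image] at this
      have h2 : X.image ((a⁻¹ * ·) ∘ (a * ·)) = X := by
        rw [show ((a⁻¹ * ·) ∘ (a * ·)) = id by funext x; simp, Finset.image_id]
      rw [← this, h2]
    · have := congrArg (Finset.image (· * a⁻¹)) ha2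
      rw [Finset.image_image] at this
      have h2 : X.image ((· * a⁻¹) ∘ (· * a)) = X := by
        rw [show ((· * a⁻¹) ∘ (· * a)) = id by funext x; simp, Finset.image_id]
      rw [← this, h2]

end

instance nePow (a k : ℕ) [NeZero a] : NeZero (a ^ k) := ⟨pow_ne_zero k (NeZero.ne a)⟩

open Finset in
/-- Coefficients of `ind`. -/
lemma ind_coeff {G : Type*} [Group G] (X : Finset G) (g : G) :
    (ind X).coeff g = if g ∈ X then 1 else 0 := by
  unfold ind
  rw [MonoidAlgebra.coeff_sum, Finsupp.finsetSum_apply]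
  simp [MonoidAlgebra.coeff_single, Finsupp.single_apply]

lemma mem_spanA_iff {G : Type*} [Group G] [Fintype G] {S : Finset (Finset G)} (hS : IsSRing S)
    (a : MonoidAlgebra ℤ G) :
    a ∈ spanA S ↔ ∀ X ∈ S, ∀ x ∈ X, ∀ y ∈ X, a.coeff x = a.coeff y := by
  constructor
  · intro h
    unfold spanA at h
    induction h using Submodule.span_induction with
    | mem z hz =>
      obtain ⟨Y, hY, rfl⟩ := hz
      intro X hX x hx y hy
      rw [ind_coeff, ind_coeff]
      by_cases hXY : X = Y
      · subst hXY; simp [hx, hy]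
      · have := Finset.disjoint_left.1 (hS.disj X hX Y hY hXY)
        simp [this hx, this hy]
    | zero => simp
    | add u v _ _ hu hv =>
      intro X hX x hx y hy
      simp [hu X hX x hx y hy, hv X hX x hx y hy]
    | smul c u _ hu =>
      intro X hX x hx y hy
      rw [MonoidAlgebra.coeff_smul_apply, MonoidAlgebra.coeff_smul_apply, hu X hX x hx y hy]
  · intro h
    choose! f hf using hS.nonempty
    have : a = ∑ X ∈ S, a.coeff (f X) • ind X := by
      apply MonoidAlgebra.coeff_injective
      ext g
      rw [MonoidAlgebra.coeff_sum, Finsupp.finsetSum_apply]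
      obtain ⟨X, hX, hg⟩ := hS.cover g
      rw [Finset.sum_eq_single X]
      · rw [MonoidAlgebra.coeff_smul_apply, ind_coeff]
        simp [hg, h X hX g hg _ (hf X hX)]
      · intro Y hY hne
        have := Finset.disjoint_left.1 (hS.disj X hX Y hY (Ne.symm hne)) hg
        rw [MonoidAlgebra.coeff_smul_apply, ind_coeff]
        simp [this]
      · intro h'; exact absurd hX h'
    rw [this]
    exact Submodule.sum_mem _ fun X hX => Submodule.smul_mem _ _
      (Submodule.subset_span ⟨X, hX, rfl⟩)

lemma isASet_iff {G : Type*} [Group G] [Fintype G] {S : Finset (Finset G)} (hS : IsSRing S)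
    (B : Finset G) :
    IsASet S B ↔ ∀ X ∈ S, ∀ x ∈ X, ∀ y ∈ X, x ∈ B → y ∈ B := by
  unfold IsASet
  rw [mem_spanA_iff hS]
  simp only [ind_coeff]
  constructor
  · intro h X hX x hx y hy hxB
    have := h X hX x hx y hy
    by_contra hyB
    simp [hxB, hyB] at this
  · intro h X hX x hx y hy
    have h1 := h X hX x hx y hy
    have h2 := h X hX y hy x hx
    by_cases hxB : x ∈ B
    · simp [hxB, h1 hxB]
    · have : y ∉ B := fun hyB => hxB (h2 hyB)
      simp [hxB, this]

lemma isASet_basic {G : Type*} [Group G] [Fintype G] {S : Finset (Finset G)}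
    {X : Finset G} (hX : X ∈ S) : IsASet S X :=
  Submodule.subset_span ⟨X, hX, rfl⟩

lemma coeff_mul_fintype {R G : Type*} [Semiring R] [Group G] [Fintype G] (x y : MonoidAlgebra R G) (g : G) :
    (x * y).coeff g = ∑ h : G, x.coeff (g * h⁻¹) * y.coeff h := by
  rw [MonoidAlgebra.coeff_mul, Finsupp.sum_fintype]
  · simp_rw [fun (i : G) (c : R) => Finsupp.sum_fintype y.coeff (fun m₂ r₂ => if i * m₂ = g then c * r₂ else 0) (by simp)]
    rw [Finset.sum_comm]
    refine Finset.sum_congr rfl fun h _ => ?_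
    rw [Finset.sum_eq_single (g * h⁻¹)]
    · simp
    · intro b _ hb
      rw [if_neg]
      rintro rfl
      simp at hb
    · simp
  · intro i
    simp

/-- inversion on the group ring -/
noncomputable def starA {G : Type*} [Group G] [Fintype G] (e : MonoidAlgebra ℤ G) : MonoidAlgebra ℤ G :=
  MonoidAlgebra.ofCoeff (Finsupp.equivFunOnFinite.symm fun g => e.coeff g⁻¹)

lemma starA_coeff {G : Type*} [Group G] [Fintype G] (e : MonoidAlgebra ℤ G) (g : G) :
    (starA e).coeff g = e.coeff g⁻¹ := by
  simp [starA]

lemma starA_mem {G : Type*} [Group G] [Fintype G] {S : Finset (Finset G)} (hS : IsSRing S)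
    {e : MonoidAlgebra ℤ G} (he : e ∈ spanA S) : starA e ∈ spanA S := by
  rw [mem_spanA_iff hS] at he ⊢
  intro X hX x hx y hy
  rw [starA_coeff, starA_coeff]
  exact he _ (hS.inv_mem X hX) _ (Finset.mem_image_of_mem _ hx) _ (Finset.mem_image_of_mem _ hy)

/-- autocorrelation coefficients are constant on basic sets -/
lemma autocorr {G : Type*} [CommGroup G] [Fintype G] {S : Finset (Finset G)} (hS : IsSRing S)
    {e : MonoidAlgebra ℤ G} (he : e ∈ spanA S) {X : Finset G} (hX : X ∈ S) {x y : G}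
    (hx : x ∈ X) (hy : y ∈ X) :
    ∑ h : G, e.coeff (x * h) * e.coeff h = ∑ h : G, e.coeff (y * h) * e.coeff h := by
  have h1 := (mem_spanA_iff hS _).1 (hS.mul_closed _ he _ (starA_mem hS he)) X hX x hx y hy
  rw [coeff_mul_fintype, coeff_mul_fintype] at h1
  simp only [starA_coeff] at h1
  rw [← Equiv.sum_comp (Equiv.inv G) (fun h => e.coeff (x * h) * e.coeff h), ← Equiv.sum_comp (Equiv.inv G) (fun h => e.coeff (y * h) * e.coeff h)]
  simpa using h1

/-- stabilizer of a group ring element -/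
def stabA {G : Type*} [CommGroup G] (e : MonoidAlgebra ℤ G) : Subgroup G where
  carrier := {g | ∀ h, e.coeff (g * h) = e.coeff h}
  one_mem' := by simp
  mul_mem' := by
    intro a b ha hb h
    rw [mul_assoc, ha, hb]
  inv_mem' := by
    intro a ha h
    have := ha (a⁻¹ * h)
    simpa using this.symm

lemma mem_stabA_iff {G : Type*} [CommGroup G] [Fintype G] (e : MonoidAlgebra ℤ G) (g : G) :
    g ∈ stabA e ↔ ∑ h : G, e.coeff (g * h) * e.coeff h = ∑ h : G, e.coeff h * e.coeff h := by
  constructor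
  · intro hg
    exact Finset.sum_congr rfl fun h _ => by rw [hg h]
  · intro heq
    have h2 : ∑ h : G, e.coeff (g * h) * e.coeff (g * h) = ∑ h : G, e.coeff h * e.coeff h :=
      Equiv.sum_comp (Equiv.mulLeft g) (fun h => e.coeff h * e.coeff h)
    have h3 : ∑ h : G, (e.coeff (g * h) - e.coeff h) ^ 2 = 0 := by
      have : ∀ h, (e.coeff (g * h) - e.coeff h) ^ 2 = e.coeff (g * h) * e.coeff (g * h)
        - 2 * (e.coeff (g * h) * e.coeff h) + e.coeff h * e.coeff h := fun h => by ring
      simp_rw [this]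
      rw [Finset.sum_add_distrib, Finset.sum_sub_distrib, ← Finset.mul_sum, heq, h2]
      ring
    intro h
    rw [Finset.sum_eq_zero_iff_of_nonneg (fun i _ => sq_nonneg _)] at h3
    have := h3 h (Finset.mem_univ _)
    have := pow_eq_zero_iff (two_ne_zero) |>.1 this
    linarith

lemma stabA_isASubgroup {G : Type*} [CommGroup G] [Fintype G] {S : Finset (Finset G)} (hS : IsSRing S)
    {e : MonoidAlgebra ℤ G} (he : e ∈ spanA S) : IsASubgroup S (stabA e) := by
  unfold IsASubgroup
  rw [isASet_iff hS]
  intro X hX x hx y hy hxB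
  simp only [subgroupFinset, Finset.mem_filter, Finset.mem_univ, true_and] at hxB ⊢
  rw [mem_stabA_iff] at hxB ⊢
  rw [← autocorr hS he hX hx hy, hxB]

/-- Fourier inversion: a function with vanishing transform vanishes -/
lemma fourier_inj {G : Type*} [CommGroup G] [Fintype G] (f : G → ℂ)
    (hf : ∀ χ : G →* ℂ, ∑ g, f g * χ g = 0) : f = 0 := by
  funext g0
  have key : ∀ χ : AddChar (Additive G) ℂ, ∑ g : G, f g * χ (Additive.ofMul g) = 0 := by
    intro χ
    exact hf ⟨⟨fun g => χ (Additive.ofMul g), by simp⟩, by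
      intro x y; simp [AddChar.map_add_eq_mul]⟩
  have h2 : ∑ χ : AddChar (Additive G) ℂ, χ (Additive.ofMul g0⁻¹) * ∑ g : G, f g * χ (Additive.ofMul g) = 0 := by
    simp [key]
  simp_rw [Finset.mul_sum] at h2
  rw [Finset.sum_comm] at h2
  have h3 : ∀ g : G, ∑ χ : AddChar (Additive G) ℂ, χ (Additive.ofMul g0⁻¹) * (f g * χ (Additive.ofMul g))
      = f g * if g = g0 then (Fintype.card G : ℂ) else 0 := by
    intro g
    have : ∀ χ : AddChar (Additive G) ℂ, χ (Additive.ofMul g0⁻¹) * (f g * χ (Additive.ofMul g))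
      = f g * χ (Additive.ofMul (g0⁻¹ * g)) := by
      intro χ
      rw [ofMul_mul, AddChar.map_add_eq_mul]; ring
    simp_rw [this]
    rw [← Finset.mul_sum, AddChar.sum_apply_eq_ite]
    congr 1
    have : (Additive.ofMul (g0⁻¹ * g) = 0) ↔ g = g0 := by
      rw [ofMul_eq_zero, inv_mul_eq_one, eq_comm]
    simp only [this]
    rw [show Fintype.card (Additive G) = Fintype.card G from Fintype.card_congr Additive.toMul]
  simp_rw [h3] at h2
  simp at h2
  exact h2

lemma exists_char_ne {G : Type*} [CommGroup G] [Fintype G] (g : G) (hg : g ≠ 1) :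
    ∃ χ : G →* ℂ, χ g ≠ 1 := by
  obtain ⟨χ, hχ⟩ := AddChar.exists_apply_ne_zero.2 (show Additive.ofMul g ≠ 0 from hg)
  exact ⟨⟨⟨fun g => χ (Additive.ofMul g), by simp⟩, by
      intro x y; simp [AddChar.map_add_eq_mul]⟩, hχ⟩

lemma schur_prime {G : Type*} [CommGroup G] [Fintype G] {S : Finset (Finset G)} (hS : IsSRing S)
    (q : ℕ) (hq : q.Prime) (hcop : (Fintype.card G).Coprime q) (B : Finset G) (hB : IsASet S B) :
    IsASet S (B.image (· ^ q)) := by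
  have : Fact q.Prime := ⟨hq⟩
  have hone : (1 : MonoidAlgebra ℤ G) ∈ spanA S := by
    have := isASet_basic hS.one_mem
    unfold IsASet ind at this
    simpa [MonoidAlgebra.one_def] using this
  have hpow : ∀ k : ℕ, (ind B) ^ k ∈ spanA S := by
    intro k
    induction k with
    | zero => simpa using hone
    | succ k ih => rw [pow_succ]; exact hS.mul_closed _ ih _ hB
  have hch : CharP (MonoidAlgebra (ZMod q) G) q := by
    refine (CharP.charP_iff_prime_eq_zero hq).2 ?_
    have : (q : MonoidAlgebra (ZMod q) G) = algebraMap (ZMod q) _ (q : ZMod q) := (map_natCast _ _).symm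
    rw [this, CharP.cast_eq_zero, map_zero]
  have hinj : Function.Injective (fun x : G => x ^ q) := by
    have := (powCoprime (G := G) (n := q) (by rwa [Nat.card_eq_fintype_card])).injective
    exact this
  have hc : ∀ g : G, (((ind B) ^ q).coeff g : ZMod q) = if g ∈ B.image (· ^ q) then 1 else 0 := by
    intro g
    have h1 : MonoidAlgebra.mapRingHom G (Int.castRingHom (ZMod q)) ((ind B) ^ q)
        = ∑ x ∈ B, MonoidAlgebra.single (x ^ q) 1 := by
      rw [map_pow]
      unfold ind
      rw [map_sum, sum_pow_char]
      refine Finset.sum_congr rfl fun x _ => ?_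
      simp [MonoidAlgebra.single_pow]
    have h2 := congrArg (fun z => z.coeff g) h1
    simp only [MonoidAlgebra.coeff_sum, Finsupp.finsetSum_apply] at h2
    rw [← Finset.sum_image (f := fun y => (MonoidAlgebra.single y (1 : ZMod q)).coeff g)
      (hinj.injOn)] at h2
    have h3 : ((MonoidAlgebra.mapRingHom G (Int.castRingHom (ZMod q))) (ind B ^ q)).coeff g
        = (((ind B) ^ q).coeff g : ZMod q) := by
      simp [-map_pow]
    rw [h3] at h2
    rw [h2]
    simp [MonoidAlgebra.coeff_single, Finsupp.single_apply]
  rw [isASet_iff hS]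
  intro X hX x hx y hy hxB
  have h := (mem_spanA_iff hS _).1 (hpow q) X hX x hx y hy
  have h1 := hc x
  have h2 := hc y
  rw [← h, h1, if_pos hxB] at h2
  by_contra hyB
  rw [if_neg hyB] at h2
  exact one_ne_zero h2

lemma schur_mult {G : Type*} [CommGroup G] [Fintype G] {S : Finset (Finset G)} (hS : IsSRing S)
    (m : ℕ) (hcop : (Fintype.card G).Coprime m) (hm : m ≠ 0) (B : Finset G) (hB : IsASet S B) :
    IsASet S (B.image (· ^ m)) := by
  induction m using Nat.recOnMul generalizing B with
  | zero => exact absurd rfl hm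
  | one => simpa using hB
  | prime q hq => exact schur_prime hS q hq hcop B hB
  | mul a b iha ihb =>
    have h1 := iha (Nat.Coprime.coprime_mul_right_right hcop) (by rintro rfl; simp at hm) B hB
    have h2 := ihb (Nat.Coprime.coprime_mul_left_right hcop) (by rintro rfl; simp at hm) _ h1
    rw [Finset.image_image] at h2
    have : ((fun x : G => x ^ b) ∘ fun x => x ^ a) = fun x => x ^ (a * b) := by
      funext x; simp [pow_mul]
    rwa [this] at h2
/-- closed under powers coprime to `p` -/
def IsRat {G : Type*} [Group G] (p : ℕ) (U : Finset G) : Prop :=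
  ∀ m : ℕ, m.Coprime p → ∀ x ∈ U, x ^ m ∈ U

/-- rational hull -/
noncomputable def ratHull {G : Type*} [Group G] [Fintype G] (p : ℕ) (X : Finset G) : Finset G :=
  Finset.univ.filter fun y => ∃ x ∈ X, ∃ m : ℕ, m.Coprime p ∧ y = x ^ m

lemma mem_ratHull {G : Type*} [Group G] [Fintype G] {p : ℕ} {X : Finset G} {y : G} :
    y ∈ ratHull p X ↔ ∃ x ∈ X, ∃ m : ℕ, m.Coprime p ∧ y = x ^ m := by
  simp [ratHull]

lemma ratHull_isRat {G : Type*} [Group G] [Fintype G] (p : ℕ) (X : Finset G) :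
    IsRat p (ratHull p X) := by
  intro m hm x hx
  obtain ⟨z, hz, n, hn, rfl⟩ := mem_ratHull.1 hx
  exact mem_ratHull.2 ⟨z, hz, n * m, Nat.Coprime.mul_left hn hm, by rw [pow_mul]⟩

lemma subset_ratHull {G : Type*} [Group G] [Fintype G] (p : ℕ) (X : Finset G) :
    X ⊆ ratHull p X := fun x hx => mem_ratHull.2 ⟨x, hx, 1, by simp, by simp⟩

lemma ne_zero_of_coprime {p m : ℕ} (hp : p.Prime) (h : m.Coprime p) : m ≠ 0 := by
  rintro rfl
  simp at h
  exact hp.one_lt.ne' h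

lemma pow_inj {G : Type*} [CommGroup G] [Fintype G] {p n m : ℕ}
    (hcard : Fintype.card G = p ^ n) (hm : m.Coprime p) :
    Function.Injective (fun x : G => x ^ m) := by
  have := (powCoprime (G := G) (n := m) (by
    rw [Nat.card_eq_fintype_card, hcard]
    exact (Nat.Coprime.pow_right n hm).symm)).injective
  exact this

lemma pow_isASet {G : Type*} [CommGroup G] [Fintype G] {S : Finset (Finset G)} (hS : IsSRing S)
    {p n : ℕ} (hp : p.Prime) (hcard : Fintype.card G = p ^ n) {m : ℕ} (hm : m.Coprime p)
    {B : Finset G} (hB : IsASet S B) : IsASet S (B.image (· ^ m)) := by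
  refine schur_mult hS m ?_ (ne_zero_of_coprime hp hm) B hB
  rw [hcard]; exact (Nat.Coprime.pow_right n hm).symm

lemma ratHull_isASet {G : Type*} [CommGroup G] [Fintype G] {S : Finset (Finset G)} (hS : IsSRing S)
    {p n : ℕ} (hp : p.Prime) (hcard : Fintype.card G = p ^ n)
    {X : Finset G} (hX : IsASet S X) : IsASet S (ratHull p X) := by
  rw [isASet_iff hS]
  intro Y hY y hy z hz hyU
  obtain ⟨x, hx, m, hm, rfl⟩ := mem_ratHull.1 hyU
  have := (isASet_iff hS _).1 (pow_isASet hS hp hcard hm hX) Y hY _ hy z hz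
    (Finset.mem_image_of_mem _ hx)
  obtain ⟨w, hw, rfl⟩ := Finset.mem_image.1 this
  exact mem_ratHull.2 ⟨w, hw, m, hm, rfl⟩

lemma one_notMem_ratHull {G : Type*} [CommGroup G] [Fintype G]
    {p n : ℕ} (hcard : Fintype.card G = p ^ n)
    {X : Finset G} (hX : (1 : G) ∉ X) : (1 : G) ∉ ratHull p X := by
  intro h
  obtain ⟨x, hx, m, hm, h1⟩ := mem_ratHull.1 h
  have : x = 1 := pow_inj hcard hm (by simpa using h1.symm)
  exact hX (this ▸ hx)

/-- The integer `(p-1) χ(U)`. -/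
noncomputable def cc {G : Type*} [Group G] (p : ℕ) (U : Finset G) (χ : G →* ℂ) : ℤ :=
  p * (U.filter fun x => χ x = 1).card - (U.filter fun x => χ x ^ p = 1).card

lemma geom_root (N : ℕ) (ζ : ℂ) (h : ζ ^ N = 1) :
    ∑ m ∈ Finset.range N, ζ ^ m = if ζ = 1 then (N : ℂ) else 0 := by
  split_ifs with h1
  · simp [h1]
  · rw [geom_sum_eq h1, h]; simp

lemma sum_coprime (p k : ℕ) (hp : p.Prime) (f : ℕ → ℂ) :
    ∑ m ∈ (Finset.range (p ^ (k + 1))).filter (fun m => m.Coprime p), f m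
      = ∑ m ∈ Finset.range (p ^ (k + 1)), f m - ∑ m ∈ Finset.range (p ^ k), f (p * m) := by
  rw [eq_sub_iff_add_eq, ← Finset.sum_filter_add_sum_filter_not (Finset.range (p ^ (k + 1)))
    (fun m => m.Coprime p)]
  congr 1
  rw [← Finset.sum_image (f := f) (g := fun m => p * m)
    (fun x _ y _ h => Nat.eq_of_mul_eq_mul_left hp.pos h)]
  apply Finset.sum_congr _ (fun _ _ => rfl)
  ext m
  simp only [Finset.mem_image, Finset.mem_range, Finset.mem_filter]
  constructor
  · rintro ⟨j, hj, rfl⟩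
    refine ⟨?_, ?_⟩
    · rw [pow_succ, mul_comm]; exact Nat.mul_lt_mul_of_pos_right hj hp.pos
    · rw [Nat.coprime_comm, hp.coprime_iff_not_dvd]; simp
  · rintro ⟨h1, h2⟩
    rw [Nat.coprime_comm, hp.coprime_iff_not_dvd, not_not] at h2
    obtain ⟨j, rfl⟩ := h2
    refine ⟨j, ?_, rfl⟩
    rw [pow_succ, mul_comm] at h1
    exact Nat.lt_of_mul_lt_mul_right h1

lemma ramanujan {G : Type*} [CommGroup G] [Fintype G] {p n k : ℕ} (hp : p.Prime)
    (hcard : Fintype.card G = p ^ n) (hexp : ∀ g : G, g ^ p ^ (k + 1) = 1)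
    {U : Finset G} (hU : IsRat p U) (χ : G →* ℂ) :
    ((p : ℂ) - 1) * ∑ x ∈ U, χ x = cc p U χ := by
  set T := (Finset.range (p ^ (k + 1))).filter (fun m => m.Coprime p) with hT
  have h1 : ∀ m ∈ T, ∑ x ∈ U, χ x ^ m = ∑ x ∈ U, χ x := by
    intro m hm
    have hmc : m.Coprime p := (Finset.mem_filter.1 hm).2
    have him : U.image (· ^ m) = U := by
      apply Finset.eq_of_subset_of_card_le
      · intro y hy
        obtain ⟨x, hx, rfl⟩ := Finset.mem_image.1 hy
        exact hU m hmc x hx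
      · rw [Finset.card_image_of_injective _ (pow_inj hcard hmc)]
    conv_rhs => rw [← him, Finset.sum_image ((pow_inj hcard hmc).injOn)]
    exact Finset.sum_congr rfl fun x _ => by simp
  have h2 : ∑ m ∈ T, ∑ x ∈ U, χ x ^ m = (T.card : ℂ) * ∑ x ∈ U, χ x := by
    rw [Finset.sum_congr rfl h1]; simp
  have hTc : (T.card : ℂ) = (p : ℂ) ^ k * (p - 1) := by
    have := sum_coprime p k hp (fun _ => 1)
    simp only [Finset.sum_const, nsmul_eq_mul, mul_one, Finset.card_range] at this
    rw [hT, this]; push_cast; ring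
  have h3 : ∀ x ∈ U, ∑ m ∈ T, χ x ^ m = (p : ℂ) ^ k *
      (p * (if χ x = 1 then 1 else 0) - (if χ x ^ p = 1 then 1 else 0)) := by
    intro x _
    rw [hT, sum_coprime p k hp (fun m => χ x ^ m), geom_root _ _ (by rw [← map_pow, hexp, map_one])]
    simp_rw [pow_mul]
    rw [geom_root _ _ (by rw [← pow_mul, ← pow_succ', ← map_pow, hexp, map_one])]
    split_ifs <;> push_cast <;> ring
  rw [Finset.sum_comm, Finset.sum_congr rfl h3, ← Finset.mul_sum, hTc, mul_assoc] at h2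
  have hpk : (p : ℂ) ^ k ≠ 0 := pow_ne_zero _ (by exact_mod_cast hp.ne_zero)
  rw [← mul_left_cancel₀ hpk h2, Finset.sum_sub_distrib, ← Finset.mul_sum]
  simp [cc, Finset.sum_ite]

lemma one_mem_spanA {G : Type*} [Group G] [Fintype G] {S : Finset (Finset G)} (hS : IsSRing S) :
    (1 : MonoidAlgebra ℤ G) ∈ spanA S := by
  have := isASet_basic hS.one_mem
  unfold IsASet ind at this
  simpa [MonoidAlgebra.one_def] using this

/-- extension of a character to the group ring -/
noncomputable def chA {G : Type*} [CommGroup G] (χ : G →* ℂ) : MonoidAlgebra ℤ G →ₐ[ℤ] ℂ :=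
  MonoidAlgebra.lift ℤ ℂ G χ

lemma chA_ind {G : Type*} [CommGroup G] (χ : G →* ℂ) (U : Finset G) :
    chA χ (ind U) = ∑ x ∈ U, χ x := by
  unfold chA ind
  rw [map_sum]
  exact Finset.sum_congr rfl fun x _ => by rw [MonoidAlgebra.lift_single]; simp

lemma chA_eq {G : Type*} [CommGroup G] [Fintype G] (χ : G →* ℂ) (e : MonoidAlgebra ℤ G) :
    chA χ e = ∑ g : G, (e.coeff g : ℂ) * χ g := by
  unfold chA
  rw [MonoidAlgebra.lift_apply, Finsupp.sum_fintype _ _ (by simp)]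
  exact Finset.sum_congr rfl fun x _ => by simp

lemma sum_shift {G : Type*} [CommGroup G] [Fintype G] (f : G → ℂ) (χ : G →* ℂ) (v : G) :
    χ v * ∑ g : G, f (v * g) * χ g = ∑ g, f g * χ g := by
  rw [← Equiv.sum_comp (Equiv.mulLeft v) (fun g => f g * χ g), Finset.mul_sum]
  refine Finset.sum_congr rfl fun g _ => ?_
  simp only [Equiv.coe_mulLeft, map_mul]
  ring

lemma char_ne_zero {G : Type*} [CommGroup G] (χ : G →* ℂ) (v : G) : χ v ≠ 0 := by
  intro h
  have : χ v * χ v⁻¹ = 1 := by rw [← map_mul]; simp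
  simp [h] at this

lemma mem_stabA_of_char {G : Type*} [CommGroup G] [Fintype G] {e : MonoidAlgebra ℤ G} {v : G}
    (h : ∀ χ : G →* ℂ, χ v ≠ 1 → chA χ e = 0) : v ∈ stabA e := by
  have := fourier_inj (fun g => (e.coeff (v * g) : ℂ) - e.coeff g) ?_
  · intro g
    have h1 := congrFun this g
    simp only [Pi.zero_apply, sub_eq_zero] at h1
    exact_mod_cast h1
  · intro χ
    have h1 := sum_shift (fun g => (e.coeff g : ℂ)) χ v
    simp only [sub_mul, Finset.sum_sub_distrib]
    rw [← chA_eq] at h1 ⊢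
    by_cases hv : χ v = 1
    · rw [hv, one_mul] at h1; rw [h1, sub_self]
    · rw [h χ hv] at h1 ⊢
      rw [(mul_eq_zero.1 h1).resolve_left (char_ne_zero χ v), sub_self]

lemma char_of_mem_stabA {G : Type*} [CommGroup G] [Fintype G] {e : MonoidAlgebra ℤ G} {v : G}
    (h : v ∈ stabA e) (χ : G →* ℂ) : χ v * chA χ e = chA χ e := by
  have h1 := sum_shift (fun g => (e.coeff g : ℂ)) χ v
  rw [← chA_eq] at h1
  rw [← h1]
  congr 1
  rw [h1, chA_eq]
  exact Finset.sum_congr rfl fun g _ => by rw [h g]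

lemma exists_conj_char {G : Type*} [CommGroup G] [Fintype G] {p n k : ℕ} (hp : p.Prime)
    (hcard : Fintype.card G = p ^ n) (hexp : ∀ g : G, g ^ p ^ (k + 1) = 1)
    {S : Finset (Finset G)} (hS : IsSRing S)
    (hprim : ∀ K : Subgroup G, IsASubgroup S K → K = ⊥ ∨ K = ⊤)
    {U : Finset G} (hU : IsRat p U) (hUA : IsASet S U) (χ₀ : G →* ℂ) (hχ₀ : ∃ g, χ₀ g ≠ 1)
    (v : G) (hv : v ≠ 1) : ∃ χ : G →* ℂ, χ v ≠ 1 ∧ cc p U χ = cc p U χ₀ := by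
  by_contra hcon
  push Not at hcon
  obtain ⟨g₀, hg₀⟩ := hχ₀
  set B : ℤ := p * U.card with hB
  set W := (Finset.Icc (-B) B).filter (fun w => w ≠ cc p U χ₀) with hW
  set e : MonoidAlgebra ℤ G := ∏ w ∈ W, (((p : ℤ) - 1) • ind U - w • 1) with he
  have heA : e ∈ spanA S := by
    rw [he]
    refine Finset.prod_induction _ (fun z => z ∈ spanA S) (fun a b => ?_) (one_mem_spanA hS) ?_
    · exact fun ha hb => hS.mul_closed a ha b hb
    · intro w _
      exact Submodule.sub_mem _ (Submodule.smul_mem _ _ hUA)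
        (Submodule.smul_mem _ _ (one_mem_spanA hS))
  have hche : ∀ χ : G →* ℂ, chA χ e = ∏ w ∈ W, ((cc p U χ : ℂ) - w) := by
    intro χ
    rw [he, map_prod]
    refine Finset.prod_congr rfl fun w _ => ?_
    rw [map_sub, map_smul, map_smul, chA_ind, map_one, ← ramanujan hp hcard hexp hU χ]
    simp
  have hbd : ∀ χ : G →* ℂ, cc p U χ ∈ Finset.Icc (-B) B := by
    intro χ
    have h1 : ((U.filter fun x => χ x = 1).card : ℤ) ≤ U.card := by
      exact_mod_cast Finset.card_filter_le _ _
    have h2 : ((U.filter fun x => χ x ^ p = 1).card : ℤ) ≤ U.card := by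
      exact_mod_cast Finset.card_filter_le _ _
    have h3 : (1 : ℤ) ≤ p := by exact_mod_cast hp.one_lt.le
    have h4 : (0 : ℤ) ≤ (U.filter fun x => χ x = 1).card := by positivity
    have h5 : (0 : ℤ) ≤ (U.filter fun x => χ x ^ p = 1).card := by positivity
    rw [Finset.mem_Icc]
    unfold cc
    constructor <;> nlinarith
  have hstab : v ∈ stabA e := by
    apply mem_stabA_of_char
    intro χ hχ
    rw [hche]
    apply Finset.prod_eq_zero (i := cc p U χ)
    · exact Finset.mem_filter.2 ⟨hbd χ, hcon χ hχ⟩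
    · simp
  have htop : stabA e = ⊤ := by
    refine (hprim _ (stabA_isASubgroup hS heA)).resolve_left fun h => hv ?_
    rw [h] at hstab
    simpa using hstab
  have h0 := char_of_mem_stabA (e := e) (v := g₀) (by rw [htop]; trivial) χ₀
  have hne : chA χ₀ e ≠ 0 := by
    rw [hche, Finset.prod_ne_zero_iff]
    intro w hw
    have := (Finset.mem_filter.1 hw).2
    rw [sub_ne_zero]
    exact_mod_cast this.symm
  exact hg₀ (mul_right_cancel₀ hne (by rw [h0, one_mul]))
/-- the group theoretic hypotheses -/
structure Ctx {G : Type*} [CommGroup G] [Fintype G] (p k b : ℕ) (c : G) : Prop where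
  hp : p.Prime
  hk : 1 ≤ k
  hb : b ≤ k
  hcard : Fintype.card G = p ^ (k + 1 + b)
  hexp : ∀ g : G, g ^ p ^ (k + 1) = 1
  hc : c ^ p ^ k ≠ 1
  hu : ∀ g : G, ∃ j : ℕ, g ^ p ^ k = (c ^ p ^ k) ^ j

lemma dvd_of_root {M : Type*} [Monoid M] {p j : ℕ} (hp : p.Prime) {ζ : M} (h1 : ζ ^ p = 1)
    (h2 : ζ ≠ 1) (h3 : ζ ^ j = 1) : p ∣ j := by
  have : Fact p.Prime := ⟨hp⟩
  rw [← orderOf_eq_prime h1 h2]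
  exact orderOf_dvd_of_pow_eq_one h3

section
variable {G : Type*} [CommGroup G] [Fintype G] {p k b : ℕ} {c : G}

lemma Ctx.pk_p (H : Ctx p k b c) (g : G) : (g ^ p ^ k) ^ p = 1 := by
  rw [← pow_mul, ← pow_succ, H.hexp]

lemma Ctx.char_iff (H : Ctx p k b c) {χ : G →* ℂ} (hχ : χ (c ^ p ^ k) ≠ 1) (g : G) :
    χ (g ^ p ^ k) = 1 ↔ g ^ p ^ k = 1 := by
  constructor
  · intro h
    obtain ⟨j, hj⟩ := H.hu g
    rw [hj, map_pow] at h
    have : p ∣ j := dvd_of_root H.hp (by rw [← map_pow, H.pk_p, map_one]) hχ h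
    obtain ⟨i, rfl⟩ := this
    rw [hj, pow_mul, H.pk_p, one_pow]
  · intro h; rw [h, map_one]

lemma Ctx.exists_psi (H : Ctx p k b c) :
    ∃ ψ : G →* ℂ, (∀ g, ψ g = 1 ↔ g ^ p ^ k = 1) ∧ ∀ g, ψ g ^ p = 1 := by
  obtain ⟨χ, hχ⟩ := exists_char_ne _ H.hc
  refine ⟨χ.comp (powMonoidHom (p ^ k)), fun g => ?_, fun g => ?_⟩
  · simpa using H.char_iff hχ g
  · simp only [MonoidHom.comp_apply, powMonoidHom_apply]
    rw [← map_pow, H.pk_p, map_one]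

lemma cc_lt {p : ℕ} (hp : p.Prime) {U : Finset G} {χ : G →* ℂ} {v : G} (hv : v ∈ U)
    (hχ : χ v ≠ 1) : cc p U χ < (p - 1) * U.card := by
  have h1 : (U.filter fun x => χ x = 1).card < U.card :=
    Finset.card_lt_card (Finset.filter_ssubset.2 ⟨v, hv, hχ⟩)
  have h2 : (U.filter fun x => χ x = 1).card ≤ (U.filter fun x => χ x ^ p = 1).card := by
    apply Finset.card_le_card
    intro x hx
    rw [Finset.mem_filter] at hx ⊢
    exact ⟨hx.1, by rw [hx.2, one_pow]⟩
  have h3 : (2 : ℤ) ≤ p := by exact_mod_cast hp.two_le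
  unfold cc
  zify at h1 h2
  nlinarith

lemma Ctx.not_subset (H : Ctx p k b c) {S : Finset (Finset G)} (hS : IsSRing S)
    (hprim : ∀ K : Subgroup G, IsASubgroup S K → K = ⊥ ∨ K = ⊤)
    {U : Finset G} (hU : IsRat p U) (hUA : IsASet S U) (hne : U.Nonempty) (h1 : (1 : G) ∉ U) :
    ∃ x ∈ U, x ^ p ^ k ≠ 1 := by
  by_contra hcon
  push Not at hcon
  obtain ⟨ψ, hψ, hψp⟩ := H.exists_psi
  obtain ⟨v, hv⟩ := hne
  obtain ⟨χ, hχ, he⟩ := exists_conj_char H.hp H.hcard H.hexp hS hprim hU hUA ψ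
    ⟨c, fun h => H.hc ((hψ c).1 h)⟩ v (fun h => h1 (h ▸ hv))
  have h2 := cc_lt H.hp hv hχ
  rw [he] at h2
  have h3 : cc p U ψ = (p - 1) * U.card := by
    unfold cc
    rw [Finset.filter_true_of_mem (fun x hx => (hψ x).2 (hcon x hx)),
      Finset.filter_true_of_mem (fun x hx => hψp x)]
    ring
  omega

lemma Ctx.card_ker (H : Ctx p k b c) {χ : G →* ℂ} (hχ : χ (c ^ p ^ k) ≠ 1) :
    (Finset.univ.filter fun x => χ x = 1).card ≤ p ^ b := by
  have : Fact p.Prime := ⟨H.hp⟩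
  have hord : orderOf (χ c) = p ^ (k + 1) := by
    apply orderOf_eq_prime_pow
    · rwa [← map_pow]
    · rw [← map_pow, H.hexp, map_one]
  have h1 : ((Finset.univ.filter fun x : G => χ x = 1) ×ˢ Finset.range (p ^ (k + 1))).card
      ≤ (Finset.univ : Finset G).card := by
    apply Finset.card_le_card_of_injOn (fun z => z.1 * c ^ z.2) (by simp)
    rintro ⟨w, i⟩ h1 ⟨w', j⟩ h2 h
    simp only [Finset.coe_product, Set.mem_prod, Finset.mem_coe, Finset.mem_filter,
      Finset.mem_univ, true_and, Finset.mem_range] at h1 h2 h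
    have h3 := congrArg χ h
    rw [map_mul, map_mul, h1.1, h2.1, one_mul, one_mul, map_pow, map_pow] at h3
    have h4 : i = j := pow_injOn_Iio_orderOf (by rw [hord]; exact h1.2) (by rw [hord]; exact h2.2) h3
    subst h4
    rw [mul_left_inj] at h
    rw [h]
  rw [Finset.card_product, Finset.card_range, Finset.card_univ, H.hcard, pow_add p (k + 1) b, mul_comm] at h1
  exact Nat.le_of_mul_le_mul_left h1 (pow_pos H.hp.pos _)

lemma card_ker_p (hp : p.Prime) (χ : G →* ℂ) :
    (Finset.univ.filter fun x => χ x ^ p = 1).card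
      ≤ (Finset.univ.filter fun x => χ x = 1).card * p := by
  have h := Finset.card_le_mul_card_image_of_maps_to
    (s := Finset.univ.filter fun x => χ x ^ p = 1) (t := Polynomial.nthRootsFinset p (1 : ℂ))
    (f := χ) (fun a ha => by
      rw [Polynomial.mem_nthRootsFinset hp.pos]
      exact (Finset.mem_filter.1 ha).2) (Finset.univ.filter fun x => χ x = 1).card ?_
  · refine h.trans (Nat.mul_le_mul_left _ ?_)
    rw [Polynomial.nthRootsFinset_def]
    exact (Multiset.toFinset_card_le _).trans (Polynomial.card_nthRoots p 1)
  · intro z _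
    rcases Finset.eq_empty_or_nonempty
      ((Finset.univ.filter fun x => χ x ^ p = 1).filter fun x => χ x = z) with he | ⟨y, hy⟩
    · rw [he]; simp
    · apply Finset.card_le_card_of_injOn (fun x => x * y⁻¹)
      · intro x hx
        simp only [Finset.coe_filter, Finset.mem_filter, Finset.mem_univ, true_and,
          Set.mem_ofPred_eq] at hx hy ⊢
        rw [map_mul, hx.2, ← hy.2, ← map_mul]; simp
      · intro x _ x' _ h
        simpa using h

lemma Ctx.window (H : Ctx p k b c) {S : Finset (Finset G)} (hS : IsSRing S)
    (hprim : ∀ K : Subgroup G, IsASubgroup S K → K = ⊥ ∨ K = ⊤)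
    {U : Finset G} (hU : IsRat p U) (hUA : IsASet S U) (h1 : (1 : G) ∉ U)
    (χ₀ : G →* ℂ) (hχ₀ : ∃ g, χ₀ g ≠ 1) :
    -((p - 1) * (p : ℤ) ^ b) ≤ cc p U χ₀ ∧ cc p U χ₀ ≤ (p - 1) * ((p : ℤ) ^ b - 1) := by
  obtain ⟨χ, hχ, he⟩ := exists_conj_char H.hp H.hcard H.hexp hS hprim hU hUA χ₀ hχ₀ _ H.hc
  rw [← he]
  have e1 := H.card_ker hχ
  have e2 := card_ker_p H.hp χ
  have e3 : (U.filter fun x => χ x = 1).card + 1 ≤ (Finset.univ.filter fun x => χ x = 1).card := by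
    apply Finset.card_lt_card
    refine ⟨Finset.filter_subset_filter _ (Finset.subset_univ _), fun h => h1 ?_⟩
    exact (Finset.mem_filter.1 (h (Finset.mem_filter.2 ⟨Finset.mem_univ 1, map_one χ⟩))).1
  have key : ∀ V : Finset G, (V.filter fun x => χ x ^ p = 1).card =
      (V.filter fun x => χ x = 1).card + (V.filter fun x => χ x ^ p = 1 ∧ χ x ≠ 1).card := by
    intro V
    rw [← Finset.card_union_of_disjoint]
    · congr 1
      ext x
      simp only [Finset.mem_filter, Finset.mem_union]
      by_cases hx : χ x = 1
      · simp [hx]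
      · simp [hx]
    · rw [Finset.disjoint_left]
      intro x hx hx'
      exact (Finset.mem_filter.1 hx').2.2 (Finset.mem_filter.1 hx).2
  have e4 := key U
  have e5 := key Finset.univ
  have e6 : (U.filter fun x => χ x ^ p = 1 ∧ χ x ≠ 1).card
      ≤ (Finset.univ.filter fun x => χ x ^ p = 1 ∧ χ x ≠ 1).card :=
    Finset.card_le_card (Finset.filter_subset_filter _ (Finset.subset_univ _))
  unfold cc
  have hp2 : (2 : ℤ) ≤ p := by exact_mod_cast H.hp.two_le
  zify at e1 e2 e3 e4 e5 e6
  constructor <;> nlinarith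

lemma Ctx.exists_inv (H : Ctx p k b c) {m : ℕ} (hm : m.Coprime p) :
    ∃ m' : ℕ, m'.Coprime p ∧ ∀ x : G, (x ^ m) ^ m' = x := by
  have h1 : 1 < p ^ (k + 1) := Nat.one_lt_pow (by omega) H.hp.one_lt
  obtain ⟨m', hm'⟩ := Nat.exists_mul_mod_eq_one_of_coprime (Nat.Coprime.pow_right (k + 1) hm) h1
  have h2 : m * m' = 1 + p ^ (k + 1) * (m * m' / p ^ (k + 1)) := by
    rw [← hm'.2, hm'.2]
    conv_lhs => rw [← Nat.mod_add_div (m * m') (p ^ (k + 1)), hm'.2]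
  refine ⟨m', ?_, fun x => ?_⟩
  · rw [Nat.coprime_comm, H.hp.coprime_iff_not_dvd]
    intro hd
    have h3 : p ∣ 1 + p ^ (k + 1) * (m * m' / p ^ (k + 1)) := h2 ▸ Dvd.dvd.mul_left hd m
    have h4 : p ∣ p ^ (k + 1) * (m * m' / p ^ (k + 1)) :=
      Dvd.dvd.mul_right (dvd_pow_self p (by omega)) _
    exact H.hp.one_lt.ne' (Nat.dvd_one.1 ((Nat.dvd_add_left h4).1 h3))
  · rw [← pow_mul, h2, pow_add, pow_mul, H.hexp]; simp

lemma Ctx.pow_pk_ne (H : Ctx p k b c) {m : ℕ} (hm : m.Coprime p) {x : G} (hx : x ^ p ^ k ≠ 1) :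
    (x ^ m) ^ p ^ k ≠ 1 := by
  intro h
  rw [← pow_mul, mul_comm, pow_mul] at h
  exact hx (pow_inj H.hcard hm (by simpa using h))

lemma Ctx.card_orbit (H : Ctx p k b c) {x : G} (hx : x ^ p ^ k ≠ 1) :
    (ratHull p {x}).card = p ^ k * (p - 1) := by
  have : Fact p.Prime := ⟨H.hp⟩
  have hord : orderOf x = p ^ (k + 1) := orderOf_eq_prime_pow hx (H.hexp x)
  have h1 : ratHull p {x} =
      ((Finset.range (p ^ (k + 1))).filter (fun m => (p ^ (k + 1)).Coprime m)).image (x ^ ·) := by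
    ext y
    rw [mem_ratHull]
    simp only [Finset.mem_singleton, exists_eq_left, Finset.mem_image, Finset.mem_filter,
      Finset.mem_range]
    constructor
    · rintro ⟨m, hm, rfl⟩
      refine ⟨m % p ^ (k + 1), ⟨Nat.mod_lt _ (pow_pos H.hp.pos _), ?_⟩, ?_⟩
      · rw [Nat.coprime_comm, Nat.Coprime, ← Nat.gcd_rec]
        exact (Nat.Coprime.pow_left _ hm.symm)
      · rw [← hord, pow_mod_orderOf]
    · rintro ⟨m, ⟨-, hm⟩, rfl⟩
      exact ⟨m, (Nat.Coprime.coprime_dvd_left (dvd_pow_self p (by omega)) hm).symm, rfl⟩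
  rw [h1, Finset.card_image_of_injOn, ← Nat.totient_eq_card_coprime, Nat.totient_prime_pow_succ H.hp]
  intro i hi j hj h
  simp only [Finset.coe_filter, Finset.mem_range, Set.mem_ofPred_eq] at hi hj
  exact pow_injOn_Iio_orderOf (by rw [hord]; exact hi.1) (by rw [hord]; exact hj.1) h

lemma Ctx.card_dvd (H : Ctx p k b c) {V : Finset G} (hV : IsRat p V)
    (hVK : ∀ x ∈ V, x ^ p ^ k ≠ 1) : p ^ k * (p - 1) ∣ V.card := by
  rw [Finset.card_eq_sum_card_image (fun x => ratHull p {x}) V]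
  apply Finset.dvd_sum
  intro O hO
  obtain ⟨x, hx, rfl⟩ := Finset.mem_image.1 hO
  have : V.filter (fun y => ratHull p {y} = ratHull p {x}) = ratHull p {x} := by
    ext y
    rw [Finset.mem_filter]
    constructor
    · rintro ⟨_, h⟩
      rw [← h]
      exact subset_ratHull p {y} (by simp)
    · intro h
      obtain ⟨z, hz, m, hm, rfl⟩ := mem_ratHull.1 h
      rw [Finset.mem_singleton] at hz
      subst hz
      refine ⟨hV m hm z hx, ?_⟩
      ext w
      simp only [mem_ratHull, Finset.mem_singleton, exists_eq_left]
      constructor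
      · rintro ⟨n, hn, rfl⟩
        exact ⟨m * n, Nat.Coprime.mul_left hm hn, by rw [pow_mul]⟩
      · rintro ⟨n, hn, rfl⟩
        obtain ⟨m', hm', h'⟩ := H.exists_inv hm
        exact ⟨m' * n, Nat.Coprime.mul_left hm' hn, by rw [pow_mul, h']⟩
  rw [this, H.card_orbit (hVK x hx)]

lemma Ctx.cc_shift (H : Ctx p k b c) {S : Finset (Finset G)} (hS : IsSRing S)
    (hprim : ∀ K : Subgroup G, IsASubgroup S K → K = ⊥ ∨ K = ⊤)
    {U : Finset G} (hU : IsRat p U) (hUA : IsASet S U) (h1 : (1 : G) ∉ U)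
    {ψ : G →* ℂ} (hψ : ∀ g, ψ g = 1 ↔ g ^ p ^ k = 1) (hψp : ∀ g, ψ g ^ p = 1)
    (χ : G →* ℂ) (hχ : ∃ g, χ g ≠ 1) (hχψ : ∃ g, (χ * ψ) g ≠ 1) :
    cc p U χ = cc p U (χ * ψ) := by
  have w1 := H.window hS hprim hU hUA h1 χ hχ
  have w2 := H.window hS hprim hU hUA h1 (χ * ψ) hχψ
  have dv : ∀ θ : G →* ℂ, p ^ k * (p - 1) ∣ (U.filter fun x => x ^ p ^ k ≠ 1 ∧ θ x = 1).card := by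
    intro θ
    apply H.card_dvd
    · intro m hm x hx
      rw [Finset.mem_filter] at hx ⊢
      exact ⟨hU m hm x hx.1, H.pow_pk_ne hm hx.2.1, by rw [map_pow, hx.2.2, one_pow]⟩
    · intro x hx
      exact (Finset.mem_filter.1 hx).2.1
  have split : ∀ θ : G →* ℂ, (U.filter fun x => θ x = 1).card =
      (U.filter fun x => x ^ p ^ k = 1 ∧ θ x = 1).card
      + (U.filter fun x => x ^ p ^ k ≠ 1 ∧ θ x = 1).card := by
    intro θ
    rw [← Finset.card_union_of_disjoint]
    · congr 1
      ext x
      simp only [Finset.mem_filter, Finset.mem_union]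
      tauto
    · rw [Finset.disjoint_left]
      intro x hx hx'
      exact (Finset.mem_filter.1 hx').2.1 (Finset.mem_filter.1 hx).2.1
  obtain ⟨s, hs⟩ := dv χ
  obtain ⟨t, ht⟩ := dv (χ * ψ)
  have e1 := split χ
  have e2 := split (χ * ψ)
  have e3 : (U.filter fun x => x ^ p ^ k = 1 ∧ (χ * ψ) x = 1)
      = U.filter fun x => x ^ p ^ k = 1 ∧ χ x = 1 := by
    apply Finset.filter_congr
    intro x _
    constructor
    · rintro ⟨h, h'⟩
      rw [MonoidHom.mul_apply, (hψ x).2 h, mul_one] at h'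
      exact ⟨h, h'⟩
    · rintro ⟨h, h'⟩
      exact ⟨h, by rw [MonoidHom.mul_apply, (hψ x).2 h, mul_one, h']⟩
  have e4 : (U.filter fun x => (χ * ψ) x ^ p = 1) = U.filter fun x => χ x ^ p = 1 := by
    apply Finset.filter_congr
    intro x _
    rw [MonoidHom.mul_apply, mul_pow, hψp, mul_one]
  have hp2 : (2 : ℤ) ≤ p := by exact_mod_cast H.hp.two_le
  have hdiff : cc p U χ - cc p U (χ * ψ) = ((p : ℤ) - 1) * ((p : ℤ) ^ (k + 1) * ((s : ℤ) - t)) := by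
    unfold cc
    rw [e4, e1, e2, e3, hs, ht]
    push_cast [Nat.cast_sub H.hp.one_lt.le]
    ring
  have hpb : (p : ℤ) ^ b ≤ (p : ℤ) ^ k := pow_le_pow_right₀ (by omega) H.hb
  have hpb1 : (1 : ℤ) ≤ (p : ℤ) ^ b := one_le_pow₀ (by omega)
  have hpk : 2 * (p : ℤ) ^ k ≤ (p : ℤ) ^ (k + 1) := by
    rw [pow_succ]; nlinarith
  have hlt1 : (p : ℤ) ^ (k + 1) * ((s : ℤ) - t) < (p : ℤ) ^ (k + 1) := by
    by_contra hc'
    push Not at hc'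
    have : ((p : ℤ) - 1) * (p : ℤ) ^ (k + 1) ≤ cc p U χ - cc p U (χ * ψ) := by
      rw [hdiff]; exact mul_le_mul_of_nonneg_left hc' (by omega)
    nlinarith
  have hlt2 : -(p : ℤ) ^ (k + 1) < (p : ℤ) ^ (k + 1) * ((s : ℤ) - t) := by
    by_contra hc'
    push Not at hc'
    have : cc p U χ - cc p U (χ * ψ) ≤ ((p : ℤ) - 1) * -(p : ℤ) ^ (k + 1) := by
      rw [hdiff]; exact mul_le_mul_of_nonneg_left hc' (by omega)
    nlinarith
  have hpos : (0 : ℤ) < (p : ℤ) ^ (k + 1) := by positivity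
  have hst1 : (s : ℤ) - t < 1 := by
    by_contra hc'
    push Not at hc'
    nlinarith
  have hst2 : -1 < (s : ℤ) - t := by
    by_contra hc'
    push Not at hc'
    nlinarith
  have : (s : ℤ) - t = 0 := by omega
  rw [this] at hdiff
  simp at hdiff
  omega

lemma fourier_shift (f : G → ℂ) (v : G)
    (h : ∀ χ : G →* ℂ, χ v ≠ 1 → ∑ g, f g * χ g = 0) (g : G) : f (v * g) = f g := by
  have := fourier_inj (fun g => f (v * g) - f g) ?_
  · exact sub_eq_zero.1 (congrFun this g)
  · intro χ
    have h1 := sum_shift f χ v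
    simp only [sub_mul, Finset.sum_sub_distrib]
    by_cases hv : χ v = 1
    · rw [hv, one_mul] at h1; rw [h1, sub_self]
    · rw [h χ hv] at h1 ⊢
      rw [(mul_eq_zero.1 h1).resolve_left (char_ne_zero χ v), sub_self]

lemma Ctx.invariant (H : Ctx p k b c) {S : Finset (Finset G)} (hS : IsSRing S)
    (hprim : ∀ K : Subgroup G, IsASubgroup S K → K = ⊥ ∨ K = ⊤)
    {U : Finset G} (hU : IsRat p U) (hUA : IsASet S U) (h1 : (1 : G) ∉ U)
    {h x : G} (hh : h ^ p ^ k = 1) (hx : x ∈ U) (hxK : x ^ p ^ k ≠ 1) : h * x ∈ U := by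
  obtain ⟨ψ, hψ, hψp⟩ := H.exists_psi
  have key := fourier_shift (fun g => (if g ∈ U then 1 else 0) * (1 - ψ g)) h ?_ x
  · by_contra hc'
    simp only [hc', hx, if_true, if_false, zero_mul, one_mul] at key
    exact hxK ((hψ x).1 (sub_eq_zero.1 key.symm).symm)
  · intro χ hχ
    have hχψ : (χ * ψ) h ≠ 1 := by rwa [MonoidHom.mul_apply, (hψ h).2 hh, mul_one]
    have hcc := H.cc_shift hS hprim hU hUA h1 hψ hψp χ ⟨h, hχ⟩ ⟨h, hχψ⟩
    have r1 := ramanujan H.hp H.hcard H.hexp hU χ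
    have r2 := ramanujan H.hp H.hcard H.hexp hU (χ * ψ)
    rw [← hcc, ← r1] at r2
    have hp1 : (p : ℂ) - 1 ≠ 0 := by
      rw [sub_ne_zero]; exact_mod_cast H.hp.one_lt.ne'
    have r3 := mul_left_cancel₀ hp1 r2
    have : ∀ g : G, (if g ∈ U then (1 : ℂ) else 0) * (1 - ψ g) * χ g
        = (if g ∈ U then χ g else 0) - (if g ∈ U then (χ * ψ) g else 0) := by
      intro g
      split_ifs
      · rw [MonoidHom.mul_apply]; ring
      · simp
    simp_rw [this]
    rw [Finset.sum_sub_distrib, Finset.sum_ite_mem, Finset.sum_ite_mem, Finset.univ_inter, r3,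
      sub_self]

lemma Ctx.full (H : Ctx p k b c) {S : Finset (Finset G)} (hS : IsSRing S)
    (hprim : ∀ K : Subgroup G, IsASubgroup S K → K = ⊥ ∨ K = ⊤)
    {U : Finset G} (hU : IsRat p U) (hUA : IsASet S U) (hne : U.Nonempty) (h1 : (1 : G) ∉ U)
    {g : G} (hg : g ^ p ^ k ≠ 1) : g ∈ U := by
  obtain ⟨x, hx, hxK⟩ := H.not_subset hS hprim hU hUA hne h1
  obtain ⟨i, hi⟩ := H.hu x
  obtain ⟨j, hj⟩ := H.hu g
  have nd : ∀ {y : G} {l : ℕ}, y ^ p ^ k ≠ 1 → y ^ p ^ k = (c ^ p ^ k) ^ l → l.Coprime p := by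
    intro y l hy hl
    rw [Nat.coprime_comm, H.hp.coprime_iff_not_dvd]
    rintro ⟨l, rfl⟩
    rw [pow_mul, H.pk_p, one_pow] at hl
    exact hy hl
  have hic := nd hxK hi
  have hjc := nd hg hj
  obtain ⟨i', hi'c, hi'⟩ := H.exists_inv hic
  have hm : (i' * j).Coprime p := Nat.Coprime.mul_left hi'c hjc
  have e : (x ^ (i' * j)) ^ p ^ k = g ^ p ^ k := by
    rw [hj, ← pow_mul, mul_comm, pow_mul, hi, pow_mul, hi']
  have := H.invariant hS hprim hU hUA h1 (h := g * (x ^ (i' * j))⁻¹) (x := x ^ (i' * j))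
    (by rw [mul_pow, inv_pow, e, mul_inv_cancel]) (hU _ hm x hx) (H.pow_pk_ne hm hxK)
  simpa using this

end
section
variable {G : Type*} [CommGroup G] [Fintype G] {p k b : ℕ} {c : G}

lemma basic_eq {S : Finset (Finset G)} (hS : IsSRing S) {X Y : Finset G} (hX : X ∈ S) (hY : Y ∈ S)
    {g : G} (h1 : g ∈ X) (h2 : g ∈ Y) : X = Y := by
  by_contra h
  exact Finset.disjoint_left.1 (hS.disj X hX Y hY h) h1 h2

lemma one_notMem_basic {S : Finset (Finset G)} (hS : IsSRing S) {X : Finset G} (hX : X ∈ S)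
    (hne : X ≠ {1}) : (1 : G) ∉ X :=
  fun h => hne (basic_eq hS hX hS.one_mem h (by simp))

lemma Ctx.exists_c (H : Ctx p k b c) {S : Finset (Finset G)} (hS : IsSRing S)
    (hprim : ∀ K : Subgroup G, IsASubgroup S K → K = ⊥ ∨ K = ⊤)
    {X : Finset G} (hX : X ∈ S) (hne : X ≠ {1}) : ∃ x ∈ X, ∃ m : ℕ, m.Coprime p ∧ c = x ^ m := by
  have h1 := one_notMem_basic hS hX hne
  have := H.full hS hprim (ratHull_isRat p X) (ratHull_isASet hS H.hp H.hcard (isASet_basic hX))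
    ((hS.nonempty X hX).mono (subset_ratHull p X)) (one_notMem_ratHull H.hcard h1) H.hc
  exact mem_ratHull.1 this

lemma Ctx.exists_from_c (H : Ctx p k b c) {S : Finset (Finset G)} (hS : IsSRing S)
    (hprim : ∀ K : Subgroup G, IsASubgroup S K → K = ⊥ ∨ K = ⊤)
    {X : Finset G} (hX : X ∈ S) (hne : X ≠ {1}) : ∃ m : ℕ, m.Coprime p ∧ c ^ m ∈ X := by
  obtain ⟨x, hx, m, hm, h⟩ := H.exists_c hS hprim hX hne
  obtain ⟨m', hm', h'⟩ := H.exists_inv hm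
  exact ⟨m', hm', by rw [h, h']; exact hx⟩

lemma Ctx.eq_pow (H : Ctx p k b c) {S : Finset (Finset G)} (hS : IsSRing S)
    {X : Finset G} (hX : X ∈ S) {m : ℕ} (hm : m.Coprime p) {z : G} (hz : z ∈ X)
    (hz' : z ∈ X.image (· ^ m)) : X.image (· ^ m) = X := by
  symm
  apply Finset.eq_of_subset_of_card_le
  · intro y hy
    exact (isASet_iff hS _).1 (pow_isASet hS H.hp H.hcard hm (isASet_basic hX)) X hX z hz y hy hz'
  · exact Finset.card_image_le

lemma Ctx.exists_u (H : Ctx p k b c) {S : Finset (Finset G)} (hS : IsSRing S)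
    (hprim : ∀ K : Subgroup G, IsASubgroup S K → K = ⊥ ∨ K = ⊤)
    {X : Finset G} (hX : X ∈ S) (hne : X ≠ {1}) : ∃ t : ℕ, (c ^ p ^ k) ^ t ∈ X := by
  obtain ⟨Y, hY, huY⟩ := hS.cover (c ^ p ^ k)
  have hYne : Y ≠ {1} := by
    rintro rfl
    exact H.hc (by simpa using huY)
  obtain ⟨x, hx, m, hm, h⟩ := H.exists_c hS hprim hX hne
  obtain ⟨n, hn, hy⟩ := H.exists_from_c hS hprim hY hYne
  have hmn := Nat.Coprime.mul_left hm hn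
  have := (isASet_iff hS _).1 (pow_isASet hS H.hp H.hcard hmn (isASet_basic hX)) Y hY _ hy _ huY
    (Finset.mem_image.2 ⟨x, hx, by rw [pow_mul, ← h]⟩)
  obtain ⟨w, hw, hw'⟩ := Finset.mem_image.1 this
  obtain ⟨t, ht, ht'⟩ := H.exists_inv hmn
  refine ⟨t, ?_⟩
  rw [← hw']
  rw [ht']
  exact hw

lemma Ctx.mul_u (H : Ctx p k b c) {S : Finset (Finset G)} (hS : IsSRing S)
    (hprim : ∀ K : Subgroup G, IsASubgroup S K → K = ⊥ ∨ K = ⊤)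
    {X : Finset G} (hX : X ∈ S) (hne : X ≠ {1}) {x : G} (hx : x ∈ X) (hxK : x ^ p ^ k ≠ 1) (j : ℕ) :
    (c ^ p ^ k) ^ j * x ∈ X := by
  obtain ⟨i, hi⟩ := H.hu x
  have hic : i.Coprime p := by
    rw [Nat.coprime_comm, H.hp.coprime_iff_not_dvd]
    rintro ⟨l, rfl⟩
    rw [pow_mul, H.pk_p, one_pow] at hi
    exact hxK hi
  obtain ⟨i', -, hi'⟩ := H.exists_inv hic
  obtain ⟨t, ht⟩ := H.exists_u hS hprim hX hne
  obtain ⟨q, hq⟩ : p ∣ p ^ k := dvd_pow_self p (by have := H.hk; omega)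
  have hm : (1 + p ^ k * (i' * j)).Coprime p := by
    rw [hq, mul_assoc]; simp
  have huk : (c ^ p ^ k) ^ p ^ k = 1 := by
    have h := H.pk_p c
    generalize c ^ p ^ k = w at h ⊢
    rw [hq, pow_mul, h, one_pow]
  have him := H.eq_pow hS hX hm ht (Finset.mem_image.2 ⟨_, ht, by
    rw [pow_add, pow_one, mul_eq_left, ← pow_mul, mul_comm t, pow_mul, pow_mul, huk]
    simp⟩)
  rw [← him]
  refine Finset.mem_image.2 ⟨x, hx, ?_⟩
  rw [pow_add, pow_one, pow_mul, hi, pow_mul, hi', mul_comm]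

/-- the number of representations -/
noncomputable def corr (X : Finset G) (g : G) : ℤ :=
  ∑ h : G, (ind X).coeff (g * h) * (ind X).coeff h

lemma Ctx.corr_ge (H : Ctx p k b c) {S : Finset (Finset G)} (hS : IsSRing S)
    (hprim : ∀ K : Subgroup G, IsASubgroup S K → K = ⊥ ∨ K = ⊤)
    {X : Finset G} (hX : X ∈ S) (hne : X ≠ {1}) {g : G} (hg : g ≠ 1) :
    ((X.filter fun x => x ^ p ^ k ≠ 1).card : ℤ) ≤ corr X g := by
  obtain ⟨Y, hY, hgY⟩ := hS.cover g
  have hYne : Y ≠ {1} := by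
    rintro rfl
    exact hg (by simpa using hgY)
  obtain ⟨t, ht⟩ := H.exists_u hS hprim hY hYne
  have : corr X g = corr X ((c ^ p ^ k) ^ t) := autocorr hS (isASet_basic hX) hY hgY ht
  rw [this, Finset.card_filter, ← Finset.univ_inter X, ← Finset.sum_ite_mem]
  push_cast
  unfold corr
  apply Finset.sum_le_sum
  intro h _
  rw [ind_coeff, ind_coeff]
  by_cases hh : h ∈ X
  · by_cases hK : h ^ p ^ k ≠ 1
    · simp [hh, hK, H.mul_u hS hprim hX hne hh hK t]
    · simp only [hh, hK, if_true, if_false]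
      split_ifs <;> simp
  · simp [hh]

lemma corr_one (X : Finset G) : corr X 1 = X.card := by
  simp [corr, ind_coeff]

lemma corr_sum (X : Finset G) : ∑ g : G, corr X g = (X.card : ℤ) ^ 2 := by
  unfold corr
  rw [Finset.sum_comm]
  have h0 : ∑ g : G, (ind X).coeff g = (X.card : ℤ) := by simp [ind_coeff]
  have : ∀ h : G, ∑ g : G, (ind X).coeff (g * h) * (ind X).coeff h = X.card * (ind X).coeff h := by
    intro h
    rw [← Finset.sum_mul, ← h0]
    congr 1
    exact Equiv.sum_comp (Equiv.mulRight h) (fun g => (ind X).coeff g)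
  simp_rw [this]
  rw [← Finset.mul_sum, h0, sq]

lemma Ctx.card_ineq (H : Ctx p k b c) {S : Finset (Finset G)} (hS : IsSRing S)
    (hprim : ∀ K : Subgroup G, IsASubgroup S K → K = ⊥ ∨ K = ⊤)
    {X : Finset G} (hX : X ∈ S) (hne : X ≠ {1}) :
    ((Fintype.card G : ℤ) - 1) * (X.filter fun x => x ^ p ^ k ≠ 1).card
      ≤ X.card * ((X.card : ℤ) - 1) := by
  have h1 := corr_sum X
  rw [← Finset.add_sum_erase _ _ (Finset.mem_univ (1 : G)), corr_one] at h1
  have h2 : ∑ g ∈ Finset.univ.erase (1 : G), ((X.filter fun x => x ^ p ^ k ≠ 1).card : ℤ)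
      ≤ ∑ g ∈ Finset.univ.erase (1 : G), corr X g :=
    Finset.sum_le_sum fun g hg => H.corr_ge hS hprim hX hne (Finset.ne_of_mem_erase hg)
  rw [Finset.sum_const, Finset.card_erase_of_mem (Finset.mem_univ _), nsmul_eq_mul,
    Finset.card_univ, Nat.cast_sub Fintype.card_pos] at h2
  push_cast at h2
  nlinarith

lemma Ctx.final (H : Ctx p k b c) {S : Finset (Finset G)} (hS : IsSRing S)
    (hprim : ∀ K : Subgroup G, IsASubgroup S K → K = ⊥ ∨ K = ⊤) :
    ∀ X ∈ S, X = {1} ∨ X = Finset.univ \ {1} := by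
  have hc1 : c ≠ 1 := by
    intro h
    exact H.hc (by rw [h, one_pow])
  set T := S.filter (fun X => X ≠ {1}) with hT
  have hcov : ∀ g : G, g ≠ 1 → ∃ X ∈ T, g ∈ X := by
    intro g hg
    obtain ⟨Y, hY, hgY⟩ := hS.cover g
    refine ⟨Y, Finset.mem_filter.2 ⟨hY, ?_⟩, hgY⟩
    rintro rfl
    exact hg (by simpa using hgY)
  have hTne : T.Nonempty := by
    obtain ⟨X, hX, _⟩ := hcov c hc1
    exact ⟨X, hX⟩
  obtain ⟨X, hXT, hmax⟩ := Finset.exists_max_image T Finset.card hTne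
  have hX : X ∈ S := (Finset.mem_filter.1 hXT).1
  have hXne : X ≠ {1} := (Finset.mem_filter.1 hXT).2
  -- counting
  have hsum : ∑ Y ∈ T, (Y.card : ℤ) ≤ Fintype.card G - 1 := by
    have h1 : (T.biUnion id).card = ∑ Y ∈ T, Y.card := by
      apply Finset.card_biUnion
      intro Y hY Z hZ hYZ
      exact hS.disj Y (Finset.mem_filter.1 hY).1 Z (Finset.mem_filter.1 hZ).1 hYZ
    have h2 : (T.biUnion id).card ≤ (Finset.univ.erase (1 : G)).card := by
      apply Finset.card_le_card
      intro y hy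
      obtain ⟨Y, hY, hyY⟩ := Finset.mem_biUnion.1 hy
      refine Finset.mem_erase.2 ⟨?_, Finset.mem_univ _⟩
      rintro rfl
      exact one_notMem_basic hS (Finset.mem_filter.1 hY).1 (Finset.mem_filter.1 hY).2 hyY
    rw [h1, Finset.card_erase_of_mem (Finset.mem_univ _), Finset.card_univ] at h2
    have h3 : 0 < Fintype.card G := Fintype.card_pos
    zify [h3] at h2
    exact h2
  have hout : ((Finset.univ.filter fun x : G => x ^ p ^ k ≠ 1).card : ℤ)
      ≤ ∑ Y ∈ T, ((Y.filter fun x => x ^ p ^ k ≠ 1).card : ℤ) := by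
    have : (Finset.univ.filter fun x : G => x ^ p ^ k ≠ 1)
        ⊆ T.biUnion (fun Y => Y.filter fun x => x ^ p ^ k ≠ 1) := by
      intro x hx
      have hxK := (Finset.mem_filter.1 hx).2
      obtain ⟨Y, hY, hxY⟩ := hcov x (by rintro rfl; simp at hxK)
      exact Finset.mem_biUnion.2 ⟨Y, hY, Finset.mem_filter.2 ⟨hxY, hxK⟩⟩
    have h2 := (Finset.card_le_card this).trans Finset.card_biUnion_le
    exact_mod_cast h2
  have hhalf : (Fintype.card G : ℤ) ≤ 2 * (Finset.univ.filter fun x : G => x ^ p ^ k ≠ 1).card := by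
    have h1 : (Finset.univ.filter fun x : G => x ^ p ^ k = 1).card
        ≤ (Finset.univ.filter fun x : G => x ^ p ^ k ≠ 1).card := by
      apply Finset.card_le_card_of_injOn (fun x => c * x)
      · intro x hx
        simp only [Finset.coe_filter, Finset.mem_univ, true_and, Set.mem_ofPred_eq] at hx ⊢
        rw [mul_pow, hx, mul_one]
        exact H.hc
      · intro x _ y _ h
        simpa using h
    have h2 := Finset.card_filter_add_card_filter_not (s := (Finset.univ : Finset G))
      (fun x : G => x ^ p ^ k = 1)
    rw [Finset.card_univ] at h2
    zify at h1 h2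
    linarith
  have hn : (1 : ℤ) < Fintype.card G := by
    have : Nontrivial G := ⟨c, 1, hc1⟩
    exact_mod_cast Fintype.one_lt_card
  have hbig : (Fintype.card G : ℤ) < 2 * X.card := by
    have h1 : ((Fintype.card G : ℤ) - 1) * (Finset.univ.filter fun x : G => x ^ p ^ k ≠ 1).card
        ≤ ((X.card : ℤ) - 1) * (Fintype.card G - 1) := by
      calc ((Fintype.card G : ℤ) - 1) * (Finset.univ.filter fun x : G => x ^ p ^ k ≠ 1).card
          ≤ ((Fintype.card G : ℤ) - 1)
            * ∑ Y ∈ T, ((Y.filter fun x => x ^ p ^ k ≠ 1).card : ℤ) :=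
            mul_le_mul_of_nonneg_left hout (by linarith)
        _ = ∑ Y ∈ T, ((Fintype.card G : ℤ) - 1) * ((Y.filter fun x => x ^ p ^ k ≠ 1).card : ℤ) := by
            rw [Finset.mul_sum]
        _ ≤ ∑ Y ∈ T, ((X.card : ℤ) - 1) * Y.card := by
            apply Finset.sum_le_sum
            intro Y hY
            have h2 := H.card_ineq hS hprim (Finset.mem_filter.1 hY).1 (Finset.mem_filter.1 hY).2
            have h3 : (Y.card : ℤ) ≤ X.card := by exact_mod_cast hmax Y hY
            have h4 : (0 : ℤ) ≤ Y.card := by positivity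
            nlinarith
        _ = ((X.card : ℤ) - 1) * ∑ Y ∈ T, (Y.card : ℤ) := by rw [Finset.mul_sum]
        _ ≤ _ := by
            apply mul_le_mul_of_nonneg_left hsum
            have : 0 < X.card := Finset.card_pos.2 (hS.nonempty X hX)
            have : (1 : ℤ) ≤ X.card := by exact_mod_cast this
            linarith
    have h2 : ((Finset.univ.filter fun x : G => x ^ p ^ k ≠ 1).card : ℤ) ≤ X.card - 1 := by
      by_contra hcon
      push Not at hcon
      nlinarith
    linarith
  have hinv : ∀ m : ℕ, m.Coprime p → X.image (· ^ m) = X := by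
    intro m hm
    have : ¬ Disjoint X (X.image (· ^ m)) := by
      intro hd
      have h1 := Finset.card_union_of_disjoint hd
      rw [Finset.card_image_of_injective _ (pow_inj H.hcard hm)] at h1
      have h2 := Finset.card_le_univ (X ∪ X.image (· ^ m))
      rw [h1] at h2
      zify at h2
      linarith
    rw [Finset.not_disjoint_iff] at this
    obtain ⟨z, hz, hz'⟩ := this
    exact H.eq_pow hS hX hm hz hz'
  have hpw : ∀ m : ℕ, m.Coprime p → ∀ x ∈ X, x ^ m ∈ X := by
    intro m hm x hx
    rw [← hinv m hm]
    exact Finset.mem_image_of_mem _ hx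
  have hcX : c ∈ X := by
    obtain ⟨x, hx, m, hm, h⟩ := H.exists_c hS hprim hX hXne
    rw [h]
    exact hpw m hm x hx
  have huniq : ∀ Y ∈ T, Y = X := by
    intro Y hY
    obtain ⟨m, hm, h⟩ := H.exists_from_c hS hprim (Finset.mem_filter.1 hY).1 (Finset.mem_filter.1 hY).2
    exact basic_eq hS (Finset.mem_filter.1 hY).1 hX h (hpw m hm c hcX)
  have hXeq : X = Finset.univ \ {1} := by
    ext g
    simp only [Finset.mem_sdiff, Finset.mem_univ, true_and, Finset.mem_singleton]
    constructor
    · rintro h rfl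
      exact one_notMem_basic hS hX hXne h
    · intro h
      obtain ⟨Y, hY, hgY⟩ := hcov g h
      rw [← huniq Y hY]
      exact hgY
  intro Z hZ
  by_cases hZ1 : Z = {1}
  · exact Or.inl hZ1
  · right
    rw [huniq Z (Finset.mem_filter.2 ⟨hZ, hZ1⟩)]
    exact hXeq

end

/-- every primitive S-ring over `ℤ_{p^a} × ℤ_{p^b}` with
`a > b ≥ 0` and `a > 1` has rank 2. -/
theorem stmt15 (p a b : ℕ) (hp : p.Prime) [NeZero p] (hba : b < a) (ha : 1 < a)
    (S : Finset (Finset (Multiplicative (ZMod (p ^ a)) × Multiplicative (ZMod (p ^ b)))))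
    (hS : IsSRing S)
    (hprim : ∀ K : Subgroup (Multiplicative (ZMod (p ^ a)) × Multiplicative (ZMod (p ^ b))),
      IsASubgroup S K → K = ⊥ ∨ K = ⊤) :
    ∀ X ∈ S, X = ({1} : Finset (Multiplicative (ZMod (p ^ a)) × Multiplicative (ZMod (p ^ b)))) ∨
      X = Finset.univ \ ({1} : Finset (Multiplicative (ZMod (p ^ a)) × Multiplicative (ZMod (p ^ b)))) := by
  obtain ⟨k, rfl⟩ : ∃ k, a = k + 1 := ⟨a - 1, by omega⟩
  have hbk : b ≤ k := by omega
  have hA : ∀ (n : ℕ) (x : Multiplicative (ZMod (p ^ n))), x ^ p ^ n = 1 := by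
    intro n x
    apply Multiplicative.toAdd.injective
    rw [toAdd_pow, toAdd_one, nsmul_eq_mul, ZMod.natCast_self, zero_mul]
  have hB : ∀ y : Multiplicative (ZMod (p ^ b)), y ^ p ^ k = 1 := by
    intro y
    obtain ⟨d, rfl⟩ := Nat.exists_eq_add_of_le hbk
    rw [pow_add, pow_mul, hA, one_pow]
  have H : Ctx p k b ((Multiplicative.ofAdd 1, 1) :
      Multiplicative (ZMod (p ^ (k + 1))) × Multiplicative (ZMod (p ^ b))) := by
    refine ⟨hp, by omega, hbk, ?_, ?_, ?_, ?_⟩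
    · rw [Fintype.card_prod, Fintype.card_multiplicative, Fintype.card_multiplicative, ZMod.card,
        ZMod.card, ← pow_add]
    · rintro ⟨x, y⟩
      rw [Prod.pow_mk, hA, pow_succ, pow_mul, hB, one_pow]
      rfl
    · intro h
      have h1 := congrArg (fun z => Multiplicative.toAdd z.1) h
      simp only [Prod.pow_mk, toAdd_pow, toAdd_ofAdd, nsmul_eq_mul, mul_one, Prod.fst_one,
        toAdd_one] at h1
      rw [ZMod.natCast_eq_zero_iff] at h1
      have h2 := Nat.le_of_dvd (pow_pos hp.pos _) h1
      exact absurd h2 (not_le.2 (Nat.pow_lt_pow_right hp.one_lt (Nat.lt_succ_self k)))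
    · rintro ⟨x, y⟩
      refine ⟨(Multiplicative.toAdd x).val, ?_⟩
      rw [Prod.pow_mk, Prod.pow_mk, Prod.pow_mk, hB, one_pow, one_pow]
      congr 1
      apply Multiplicative.toAdd.injective
      simp [mul_comm]
  intro X hX
  convert H.final hS hprim X hX
end

section
/- Let D = Z_3 × Z_{3^n} with n ≥ 2, and let A be an S-ring over D. Suppose that a basic set T of A is nonregular (contains elements of two distinct orders) and contains no elements of order 3. Then rad(T) = {g ∈ D : gT = T} is nontrivial. -/
open scoped BigOperators Pointwise Classical

/-- The group `D = ℤ₃ × ℤ_{3^n}` (written multiplicatively). -/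
abbrev Dgrp (n : ℕ) := Multiplicative (ZMod 3) × Multiplicative (ZMod (3 ^ n))

set_option linter.unusedSectionVars false

section SRingTools

variable {G : Type*} [CommGroup G] [Fintype G] {S : Finset (Finset G)}

/-- `P` is a union of basic sets. -/
def AS (S : Finset (Finset G)) (P : G → Prop) : Prop :=
  ∀ X ∈ S, ∀ x ∈ X, ∀ y ∈ X, P x → P y

theorem coeff_ind (X : Finset G) (g : G) : (ind X).coeff g = if g ∈ X then 1 else 0 := by
  unfold ind
  simp [Finsupp.single_apply]

theorem span_const {f : MonoidAlgebra ℤ G} (hS : IsSRing S) (hf : f ∈ spanA S) :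
    ∀ X ∈ S, ∀ x ∈ X, ∀ y ∈ X, f.coeff x = f.coeff y := by
  intro X hX x hx y hy
  unfold spanA at hf
  induction hf using Submodule.span_induction with
  | mem f hf =>
    obtain ⟨Y, hY, rfl⟩ := hf
    rw [coeff_ind, coeff_ind]
    by_cases h : X = Y
    · subst h; simp [hx, hy]
    · have := Finset.disjoint_left.1 (hS.disj X hX Y hY h)
      simp [this hx, this hy]
  | zero => simp
  | add a b _ _ ha hb => simp [ha, hb]
  | smul r a _ ha => rw [MonoidAlgebra.coeff_smul, Finsupp.smul_apply, Finsupp.smul_apply, ha]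

theorem AS.mem (hS : IsSRing S) {P : G → Prop} (hP : AS S P) :
    ind (Finset.univ.filter P) ∈ spanA S := by
  have : ind (Finset.univ.filter P) = ∑ X ∈ S.filter (fun X => ∀ x ∈ X, P x), ind X := by
    have h : Finset.univ.filter P = (S.filter (fun X => ∀ x ∈ X, P x)).biUnion id := by
      ext g
      simp only [Finset.mem_filter, Finset.mem_univ, true_and, Finset.mem_biUnion, id]
      constructor
      · intro hg
        obtain ⟨X, hX, hgX⟩ := hS.cover g
        exact ⟨X, ⟨hX, fun y hy => hP X hX g hgX y hy hg⟩, hgX⟩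
      · rintro ⟨X, ⟨_, h⟩, hg⟩
        exact h g hg
    rw [h]
    unfold ind
    rw [Finset.sum_biUnion]
    · rfl
    · intro X hX Y hY hXY
      simp only [Finset.coe_filter, Set.mem_ofPred_eq] at hX hY
      exact hS.disj X hX.1 Y hY.1 hXY
  rw [this]
  exact Submodule.sum_mem _ fun X hX =>
    Submodule.subset_span ⟨X, (Finset.mem_filter.1 hX).1, rfl⟩

theorem AS.of_mem (hS : IsSRing S) {X : Finset G} (hX : X ∈ S) : AS S (· ∈ X) := by
  intro Y hY x hx y hy h
  by_cases e : X = Y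
  · exact e ▸ hy
  · exact absurd hx (Finset.disjoint_left.1 (hS.disj X hX Y hY e) h)

theorem coeff_ind_mul (P Q : Finset G) (g : G) :
    (ind P * ind Q).coeff g = ((P.filter (fun p => p⁻¹ * g ∈ Q)).card : ℤ) := by
  have : ind P * ind Q = ∑ p ∈ P, MonoidAlgebra.single p 1 * ind Q := by
    rw [ind, Finset.sum_mul]
  rw [this, MonoidAlgebra.coeff_sum, Finset.sum_apply', Finset.card_filter]
  push_cast
  refine Finset.sum_congr rfl fun p _ => ?_
  rw [MonoidAlgebra.coeff_single_mul_apply, coeff_ind]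
  simp

/-- structure constants are constant on basic sets -/
theorem AS.count (hS : IsSRing S) {P Q : G → Prop} (hP : AS S P) (hQ : AS S Q) :
    ∀ X ∈ S, ∀ x ∈ X, ∀ y ∈ X,
      (Finset.univ.filter (fun p => P p ∧ Q (p⁻¹ * x))).card =
      (Finset.univ.filter (fun p => P p ∧ Q (p⁻¹ * y))).card := by
  intro X hX x hx y hy
  have h := span_const hS (hS.mul_closed _ (hP.mem hS) _ (hQ.mem hS)) X hX x hx y hy
  rw [coeff_ind_mul, coeff_ind_mul] at h
  simpa [Finset.filter_filter] using h

theorem AS.inv (hS : IsSRing S) {P : G → Prop} (hP : AS S P) : AS S (fun g => P g⁻¹) := by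
  intro X hX x hx y hy h
  exact hP _ (hS.inv_mem X hX) x⁻¹ (Finset.mem_image_of_mem _ hx) y⁻¹
    (Finset.mem_image_of_mem _ hy) h

/-- the set of `m`-th powers -/
def PowS (m : ℕ) (P : G → Prop) (g : G) : Prop := ∃ x, P x ∧ x ^ m = g

theorem AS.powPrime (hS : IsSRing S) {P : G → Prop} (hP : AS S P) {p : ℕ} (hp : p.Prime)
    (hc : (Nat.card G).Coprime p) : AS S (PowS p P) := by
  have : Fact p.Prime := ⟨hp⟩
  have : CharP (MonoidAlgebra (ZMod p) G) p :=
    charP_of_injective_algebraMap (FaithfulSMul.algebraMap_injective (ZMod p) _) p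
  set I := Finset.univ.filter P with hI
  have hpow : ∀ k : ℕ, ind I ^ k ∈ spanA S := by
    intro k
    induction k with
    | zero =>
      have : (1 : MonoidAlgebra ℤ G) = ind {1} := by
        simp [ind, MonoidAlgebra.one_def]
      rw [pow_zero, this]
      exact Submodule.subset_span ⟨_, hS.one_mem, rfl⟩
    | succ k ih => rw [pow_succ]; exact hS.mul_closed _ ih _ (hP.mem hS)
  have hinj : Function.Injective (fun x : G => x ^ p) := (powCoprime hc).injective
  have key : ∀ g : G, (((ind I ^ p).coeff g : ℤ) : ZMod p) = if PowS p P g then 1 else 0 := by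
    intro g
    have h1 : (((ind I ^ p).coeff g : ℤ) : ZMod p) =
        (MonoidAlgebra.mapRingHom G (Int.castRingHom (ZMod p)) (ind I ^ p)).coeff g := by
      rw [MonoidAlgebra.coeff_mapRingHom]; rfl
    rw [h1, map_pow, ind, map_sum, sum_pow_char, MonoidAlgebra.coeff_sum, Finset.sum_apply']
    simp only [MonoidAlgebra.mapRingHom_single, MonoidAlgebra.single_pow, map_one, one_pow,
      MonoidAlgebra.coeff_single, Finsupp.single_apply]
    split_ifs with h
    · obtain ⟨x, hx, rfl⟩ := h
      rw [Finset.sum_eq_single x]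
      · simp
      · intro y _ hy
        rw [if_neg]
        exact fun e => hy (hinj e)
      · intro h; simp [hI, hx] at h
    · apply Finset.sum_eq_zero
      intro x hx
      rw [if_neg]
      intro e
      exact h ⟨x, by simpa [hI] using hx, e⟩
  intro X hX x hx y hy h
  have e := span_const hS (hpow p) X hX x hx y hy
  have e2 := key x
  rw [e, key y, if_pos h] at e2
  by_contra hn
  rw [if_neg hn] at e2
  exact zero_ne_one e2

theorem AS.pow (hS : IsSRing S) (m : ℕ) : ∀ {P : G → Prop}, AS S P →
    (Nat.card G).Coprime m → AS S (PowS m P) := by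
  induction m using Nat.recOnMul with
  | zero =>
    intro P hP hc
    have h1 : Nat.card G = 1 := by simpa using hc
    have := (Nat.card_eq_one_iff_unique.1 h1).1
    intro X hX x hx y hy h
    rwa [Subsingleton.elim y x]
  | one =>
    intro P hP _ X hX x hx y hy h
    obtain ⟨z, hz, rfl⟩ := h
    exact ⟨y, hP X hX z (by simpa using hx) y hy hz, by simp⟩
  | prime p hp => intro P hP hc; exact hP.powPrime hS hp hc
  | mul a b iha ihb =>
    intro P hP hc
    have h := ihb (iha hP (Nat.Coprime.coprime_mul_right_right hc))
      (Nat.Coprime.coprime_mul_left_right hc)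
    intro X hX x hx y hy hh
    obtain ⟨z, hz, rfl⟩ := hh
    obtain ⟨w, ⟨v, hv, rfl⟩, hw⟩ := h X hX _ hx y hy ⟨z ^ a, ⟨z, hz, rfl⟩, (pow_mul z a b).symm⟩
    exact ⟨v, hv, by rw [pow_mul, hw]⟩

end SRingTools

section DFacts

variable {n : ℕ}

theorem D_pow (x : Dgrp n) : x ^ (3 ^ n * 3) = 1 := by
  have h1 : ∀ y : ZMod 3, (3 ^ n * 3) • y = 0 := fun y => by simp [nsmul_eq_mul, show (3 : ZMod 3) = 0 from rfl]
  have h2 : ∀ y : ZMod (3 ^ n), (3 ^ n * 3) • y = 0 := fun y => by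
    have h : ((3 ^ n : ℕ) : ZMod (3 ^ n)) = 0 := ZMod.natCast_self _
    rw [nsmul_eq_mul, Nat.cast_mul, h]; simp
  exact Prod.ext (h1 _) (h2 _)

theorem D_card : Nat.card (Dgrp n) = 3 ^ (n + 1) := by
  rw [Nat.card_prod]
  change Nat.card (ZMod 3) * Nat.card (ZMod (3 ^ n)) = _
  rw [Nat.card_zmod, Nat.card_zmod, pow_succ, mul_comm]

theorem fst_cube (x : Dgrp n) : (x ^ 3).1 = 1 := by
  have h1 : ∀ y : ZMod 3, 3 • y = 0 := by decide
  exact h1 _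

/-- subgroups of the cyclic factor form a chain -/
theorem D_chain {y z : Dgrp n} (hy : y.1 = 1) (hz : z.1 = 1) {i : ℕ}
    (hy' : y ^ 3 ^ (i + 1) = 1) (hz' : z ^ 3 ^ i ≠ 1) : ∃ l : ℕ, y = z ^ l := by
  have key : ∀ u v : Multiplicative (ZMod (3 ^ n)), u ^ 3 ^ (i + 1) = 1 → v ^ 3 ^ i ≠ 1 →
      ∃ l : ℕ, u = v ^ l := by
    intro u v hu hv
    have hvn : orderOf v ∣ 3 ^ n := by
      have := orderOf_dvd_natCard v
      change _ ∣ Nat.card (ZMod (3 ^ n)) at this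
      rwa [Nat.card_zmod] at this
    obtain ⟨k, -, hk⟩ := (Nat.dvd_prime_pow Nat.prime_three).1 hvn
    have hik : i + 1 ≤ k := by
      by_contra hlt
      apply hv
      rw [← orderOf_dvd_iff_pow_eq_one, hk]
      exact pow_dvd_pow _ (by omega)
    have huk : u ^ orderOf v = 1 := by
      rw [← orderOf_dvd_iff_pow_eq_one, hk]
      exact (orderOf_dvd_of_pow_eq_one hu).trans (pow_dvd_pow _ hik)
    have hpos : 0 < orderOf v := orderOf_pos v
    have hle := IsCyclic.card_pow_eq_one_le (α := Multiplicative (ZMod (3 ^ n))) hpos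
    have hsub : (Finset.range (orderOf v)).image (fun l => v ^ l) ⊆
        Finset.univ.filter (fun a => a ^ orderOf v = 1) := by
      intro w hw
      obtain ⟨l, _, rfl⟩ := Finset.mem_image.1 hw
      rw [Finset.mem_filter]
      exact ⟨Finset.mem_univ _, by rw [← pow_mul, mul_comm, pow_mul, pow_orderOf_eq_one, one_pow]⟩
    have hcard : ((Finset.range (orderOf v)).image (fun l => v ^ l)).card = orderOf v := by
      rw [Finset.card_image_of_injOn, Finset.card_range]
      intro a ha b hb h
      exact pow_injOn_Iio_orderOf (by simpa using ha) (by simpa using hb) h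
    have heq := Finset.eq_of_subset_of_card_le hsub (by rw [hcard]; convert hle)
    have hm : u ∈ Finset.univ.filter (fun a => a ^ orderOf v = 1) := by simp [huk]
    rw [← heq] at hm
    obtain ⟨l, _, h⟩ := Finset.mem_image.1 hm
    exact ⟨l, h.symm⟩
  obtain ⟨l, hl⟩ := key y.2 z.2 (by rw [← Prod.pow_snd, hy']; rfl) (by
    intro h
    apply hz'
    apply Prod.ext
    · rw [Prod.pow_fst, hz, one_pow]; rfl
    · exact h)
  refine ⟨l, Prod.ext ?_ ?_⟩
  · rw [Prod.pow_fst, hz, one_pow, hy]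
  · exact hl

/-- the subgroup of order 3 in the cyclic factor -/
def C1 (g : Dgrp n) : Prop := g.1 = 1 ∧ g ^ 3 = 1

theorem C1.one : C1 (1 : Dgrp n) := ⟨rfl, one_pow _⟩
theorem C1.mul {a b : Dgrp n} (ha : C1 a) (hb : C1 b) : C1 (a * b) :=
  ⟨by rw [Prod.fst_mul, ha.1, hb.1, one_mul], by rw [mul_pow, ha.2, hb.2, one_mul]⟩
theorem C1.inv {a : Dgrp n} (ha : C1 a) : C1 a⁻¹ :=
  ⟨by rw [Prod.fst_inv, ha.1, inv_one], by rw [inv_pow, ha.2, inv_one]⟩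
theorem C1.pow {a : Dgrp n} (ha : C1 a) (k : ℕ) : C1 (a ^ k) :=
  ⟨by rw [Prod.pow_fst, ha.1, one_pow], by rw [← pow_mul, mul_comm, pow_mul, ha.2, one_pow]⟩
theorem C1.pow3 {a : Dgrp n} (ha : C1 a) {k : ℕ} (hk : 1 ≤ k) (l : ℕ) : a ^ (3 ^ k * l) = 1 := by
  obtain ⟨k, rfl⟩ := Nat.exists_eq_add_of_le hk
  rw [pow_add, pow_one, mul_assoc, pow_mul, ha.2, one_pow]

theorem fst_pow3 (x : Dgrp n) {i : ℕ} (hi : 1 ≤ i) : (x ^ 3 ^ i).1 = 1 := by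
  obtain ⟨k, rfl⟩ := Nat.exists_eq_add_of_le hi
  rw [pow_add, pow_one, pow_mul, Prod.pow_fst, fst_cube, one_pow]

/-- G1 -/
theorem C1_pow {x c : Dgrp n} {i : ℕ} (hi : 1 ≤ i) (hx : x ^ 3 ^ i ≠ 1) (hc : C1 c) :
    ∃ l : ℕ, c = x ^ (3 ^ i * l) := by
  obtain ⟨l, hl⟩ := D_chain (i := 0) hc.1 (fst_pow3 x hi) (by simpa using hc.2) (by simpa using hx)
  exact ⟨l, by rw [hl, pow_mul]⟩

theorem C1_gen {d c : Dgrp n} (hd : C1 d) (hd1 : d ≠ 1) (hc : C1 c) :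
    ∃ l : ℕ, c = d ^ l :=
  D_chain (i := 0) hc.1 hd.1 (by simpa using hc.2) (by simpa using hd1)

theorem C1_gen3 {d c : Dgrp n} (hd : C1 d) (hd1 : d ≠ 1) (hc : C1 c) :
    c = 1 ∨ c = d ∨ c = d ^ 2 := by
  obtain ⟨l, rfl⟩ := C1_gen hd hd1 hc
  rw [← pow_mod_orderOf, orderOf_eq_prime hd.2 hd1]
  have : l % 3 < 3 := Nat.mod_lt _ (by norm_num)
  interval_cases l % 3 <;> simp

theorem pow_three_coprime {x : Dgrp n} {m : ℕ} (hm : Nat.Coprime 3 m) (h : x ^ m = 1) : x = 1 := by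
  have h1 : orderOf x ∣ m := orderOf_dvd_of_pow_eq_one h
  have h2 : orderOf x ∣ 3 ^ n * 3 := orderOf_dvd_of_pow_eq_one (D_pow x)
  have h3 : Nat.Coprime (3 ^ n * 3) m := by
    rw [← pow_succ]; exact Nat.Coprime.pow_left _ hm
  have := Nat.dvd_gcd h2 h1
  rw [h3] at this
  exact orderOf_eq_one_iff.1 (Nat.dvd_one.1 this)

theorem order_pow (x : Dgrp n) : ∃ k, orderOf x = 3 ^ k := by
  have h2 : orderOf x ∣ 3 ^ (n + 1) := orderOf_dvd_of_pow_eq_one (D_pow x)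
  obtain ⟨k, _, h⟩ := (Nat.dvd_prime_pow Nat.prime_three).1 h2
  exact ⟨k, h⟩

theorem coprime_one_add {r l : ℕ} (hr : 1 ≤ r) : Nat.Coprime 3 (1 + 3 ^ r * l) := by
  obtain ⟨k, rfl⟩ := Nat.exists_eq_add_of_le hr
  rw [Nat.Prime.coprime_iff_not_dvd Nat.prime_three, pow_add, pow_one]
  intro h
  have : 3 ∣ 3 * 3 ^ k * l := ⟨3 ^ k * l, by ring⟩
  have := (Nat.dvd_add_left this).1 h
  norm_num at this

/-- lifting the exponent -/
theorem lte_three (k : ℕ) : ∀ (r u : ℕ), 1 ≤ r → ¬ 3 ∣ u →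
    ∃ N u', ¬ 3 ∣ u' ∧ (1 + 3 ^ r * u) ^ N = 1 + 3 ^ (r + k) * u' := by
  induction k with
  | zero => intro r u _ hu; exact ⟨1, u, hu, by simp⟩
  | succ k ih =>
    intro r u hr hu
    obtain ⟨q, rfl⟩ := Nat.exists_eq_add_of_le hr
    obtain ⟨N, u', hu', h⟩ := ih (1 + q + 1)
      (u + 3 * (3 ^ q * u ^ 2 + 3 ^ (2 * q) * u ^ 3)) (by omega)
      (by rwa [Nat.dvd_add_left (Dvd.intro _ rfl)])
    refine ⟨3 * N, u', hu', ?_⟩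
    rw [pow_mul, show 1 + q + (k + 1) = 1 + q + 1 + k by ring, ← h]
    congr 1
    ring

end DFacts

section Main

variable {n : ℕ}

theorem card_coprime {m : ℕ} (hm : Nat.Coprime 3 m) : (Nat.card (Dgrp n)).Coprime m := by
  rw [D_card]; exact Nat.Coprime.pow_left _ hm

theorem pow_lt_three_inj {G : Type*} [Group G] {y : G} (h1 : y ≠ 1) (h2 : y ^ 2 ≠ 1) {l l' : ℕ}
    (hl : l < 3) (hl' : l' < 3) (h : y ^ l = y ^ l') : l = l' := by
  have h3 : y ≠ y ^ 2 := by
    intro h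
    rw [pow_two] at h
    exact h1 (by simpa using h)
  interval_cases l <;> interval_cases l' <;> first | rfl | (exfalso; simp only [pow_zero, pow_one] at h) <;>
    first | exact h1 h | exact h1 h.symm | exact h2 h | exact h2 h.symm | exact h3 h | exact h3 h.symm

set_option maxHeartbeats 1000000 in
theorem main_core {S : Finset (Finset (Dgrp n))}
    (hS : IsSRing S) {T : Finset (Dgrp n)} (hT : T ∈ S) {q : ℕ} (hq : 1 ≤ q)
    (hmin : ∀ t ∈ T, t ^ 3 ^ q ≠ 1) {a b : Dgrp n} (ha : a ∈ T) (hb : b ∈ T)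
    (hb' : b ^ 3 ^ (q + 1) = 1) (ha' : a ^ 3 ^ (q + 1) ≠ 1) :
    ∃ g : Dgrp n, g ≠ 1 ∧ ∀ x ∈ T, x * g ∈ T := by
  have hTA : AS S (· ∈ T) := AS.of_mem hS hT
  -- invariance under powers
  have hpow : ∀ m, Nat.Coprime 3 m → ∀ t ∈ T, t ^ m ∈ T → ∀ x ∈ T, x ^ m ∈ T := by
    intro m hm t ht htm x hx
    have h := hTA.pow hS m (card_coprime hm)
    have hsub : T ⊆ T.image (· ^ m) := by
      intro y hy
      obtain ⟨z, hz, hzy⟩ := h T hT (t ^ m) htm y hy ⟨t, ht, rfl⟩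
      exact Finset.mem_image.2 ⟨z, hz, hzy⟩
    rw [Finset.eq_of_subset_of_card_le hsub Finset.card_image_le]
    exact Finset.mem_image_of_mem _ hx
  -- step 1
  have hR : ∀ x ∈ T, x ^ 3 ^ (q + 1) ≠ 1 → ∀ c, C1 c → x * c ∈ T := by
    intro x hx hx' c hc
    obtain ⟨l, rfl⟩ := C1_pow (by omega) hx' hc
    have := hpow (1 + 3 ^ (q + 1) * l) (coprime_one_add (by omega)) b hb
      (by rw [pow_add, pow_mul, hb', one_pow, mul_one, pow_one]; exact hb) x hx
    rwa [pow_add, pow_one] at this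
  have hd : ∀ x : Dgrp n, x ^ 3 ^ (q + 1) = 1 → C1 (x ^ 3 ^ q) := fun x hx =>
    ⟨fst_pow3 x hq, by rw [← pow_mul, ← pow_succ, hx]⟩
  -- step 2
  by_cases hbad : ∃ t ∈ T, t ^ 3 ^ (q + 1) = 1 ∧ ∃ c, C1 c ∧ c ≠ 1 ∧ t * c ∈ T
  · obtain ⟨t, ht, ht', c, hc, hc1, htc⟩ := hbad
    refine ⟨c, hc1, fun x hx => ?_⟩
    by_cases hx' : x ^ 3 ^ (q + 1) = 1
    swap
    · exact hR x hx hx' c hc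
    obtain ⟨l, hl⟩ := C1_pow hq (hmin t ht) hc
    have hm := hpow (1 + 3 ^ q * l) (coprime_one_add hq) t ht
      (by rw [pow_add, ← hl, pow_one]; exact htc)
    have hl3 : ¬ 3 ∣ l := by
      rintro ⟨k, rfl⟩
      apply hc1
      rw [hl, ← mul_assoc, ← pow_succ, pow_mul, ht', one_pow]
    set d := x ^ (3 ^ q * l) with hdd
    have hdC : C1 d := by rw [hdd, pow_mul]; exact (hd x hx').pow l
    have hd1 : d ≠ 1 := by
      intro h
      rw [hdd, pow_mul] at h
      exact hmin x hx (pow_three_coprime ((Nat.Prime.coprime_iff_not_dvd Nat.prime_three).2 hl3) h)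
    have hk : ∀ k : ℕ, x * d ^ k ∈ T := by
      intro k
      induction k with
      | zero => simpa using hx
      | succ k ih =>
        have := hm _ ih
        have e : (x * d ^ k) ^ (1 + 3 ^ q * l) = x * d ^ (k + 1) := by
          rw [mul_pow, pow_add, pow_add (d ^ k), (hdC.pow k).pow3 hq, ← hdd, pow_one, pow_one,
            mul_one, pow_succ, mul_assoc, mul_comm d]
        rwa [e] at this
    obtain ⟨k, rfl⟩ := C1_gen hdC hd1 hc
    exact hk k
  exfalso
  have hbad' : ∀ t ∈ T, t ^ 3 ^ (q + 1) = 1 → ∀ c, C1 c → t * c ∈ T → c = 1 := by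
    intro t ht ht' c hc htc
    by_contra h
    exact hbad ⟨t, ht, ht', c, hc, h, htc⟩
  -- step 3
  have h3 : ∀ t ∈ T, t ^ 3 ^ (q + 1) = 1 → ∀ y : Dgrp n, y.1 = 1 → y ^ 3 ^ q = 1 →
      t * y ∈ T → y = 1 := by
    intro t ht ht' y hy1 hyq hty
    obtain ⟨p, rfl⟩ := Nat.exists_eq_add_of_le hq
    obtain ⟨l, hl⟩ := D_chain (y := y) (z := t ^ 3) (i := p) hy1 (fst_cube t)
      (by rwa [add_comm p 1]) (by
        rw [← pow_mul]
        have := hmin t ht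
        rwa [pow_add, pow_one] at this)
    by_contra hy
    have hl0 : l ≠ 0 := by rintro rfl; exact hy (by simpa using hl)
    obtain ⟨v, u, hu, hlu⟩ := Nat.exists_eq_pow_mul_and_not_dvd hl0 3 (by norm_num)
    have hyt : y = t ^ (3 ^ (v + 1) * u) := by
      rw [hl, hlu, ← pow_mul]; congr 1; ring
    have hvp : v ≤ p := by
      by_contra hv
      apply hy
      obtain ⟨w, rfl⟩ := Nat.exists_eq_add_of_le (not_le.1 hv)
      rw [hyt, show 3 ^ (p.succ + w + 1) * u = 3 ^ (1 + p + 1) * (3 ^ w * u) by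
        rw [Nat.succ_eq_add_one]; ring, pow_mul, ht', one_pow]
    obtain ⟨w, rfl⟩ := Nat.exists_eq_add_of_le hvp
    obtain ⟨N, u', hu', hN⟩ := lte_three w (v + 1) u (by omega) hu
    have hm := hpow (1 + 3 ^ (v + 1) * u) (coprime_one_add (by omega)) t ht
      (by rw [pow_add, pow_one, ← hyt]; exact hty)
    have hmN : ∀ N : ℕ, t ^ ((1 + 3 ^ (v + 1) * u) ^ N) ∈ T := by
      intro N
      induction N with
      | zero => simpa using ht
      | succ N ih => rw [pow_succ, pow_mul]; exact hm _ ih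
    have h1 := hmN N
    rw [hN, show v + 1 + w = 1 + (v + w) by ring, pow_add, pow_one, pow_mul] at h1
    have h2 := hbad' t ht ht' _ ((hd t ht').pow u') h1
    exact hmin t ht (pow_three_coprime ((Nat.Prime.coprime_iff_not_dvd Nat.prime_three).2 hu') h2)
  -- step 4
  set T0 := T.filter (fun t => t ^ 3 ^ (q + 1) = 1) with hT0
  set R := T.filter (fun t => ¬ t ^ 3 ^ (q + 1) = 1) with hRdef
  have hTR : T0.card + R.card = T.card := Finset.card_filter_add_card_filter_not _
  set c0 := b ^ 3 ^ q with hc0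
  have hc0C : C1 c0 := hd b hb'
  have hc01 : c0 ≠ 1 := hmin b hb
  have hsix : T0.card ≤ 6 := by
    have h : T0.card ≤ ((Finset.univ : Finset (Multiplicative (ZMod 3))) ×ˢ
        ({c0, c0 ^ 2} : Finset (Dgrp n))).card := by
      apply Finset.card_le_card_of_injOn (fun t => (t.1, t ^ 3 ^ q))
      · intro t ht
        have ht := Finset.mem_filter.1 ht
        simp only [Finset.coe_product, Set.mem_prod, Finset.mem_coe, Finset.mem_univ, true_and,
          Finset.mem_insert, Finset.mem_singleton]
        exact (C1_gen3 hc0C hc01 (hd t ht.2)).resolve_left (hmin t ht.1)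
      · intro t ht t' ht' h
        have ht := Finset.mem_filter.1 ht
        have ht' := Finset.mem_filter.1 ht'
        simp only [Prod.mk.injEq] at h
        have := h3 t ht.1 ht.2 (t⁻¹ * t') (by rw [Prod.fst_mul, Prod.fst_inv, h.1, inv_mul_cancel])
          (by rw [mul_pow, inv_pow, h.2, inv_mul_cancel]) (by simpa using ht'.1)
        exact inv_mul_eq_one.1 this
    rw [Finset.card_product] at h
    have h5 : (Finset.univ : Finset (Multiplicative (ZMod 3))).card = 3 := rfl
    have h6 : ({c0, c0 ^ 2} : Finset (Dgrp n)).card ≤ 2 := Finset.card_le_two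
    rw [h5] at h
    omega
  -- step 5
  set U : Dgrp n → Prop := fun g => ∃ l : ℕ, PowS (1 + 3 ^ q * l) (· ∈ T) g with hU
  have hUA : AS S U := by
    rintro X hX x hx y hy ⟨l, h⟩
    exact ⟨l, hTA.pow hS _ (card_coprime (coprime_one_add hq)) X hX x hx y hy h⟩
  have hUmin : ∀ g, U g → g ^ 3 ^ q ≠ 1 := by
    rintro _ ⟨l, t, ht, rfl⟩ h
    rw [← pow_mul, mul_comm, pow_mul] at h
    exact hmin t ht (pow_three_coprime (coprime_one_add hq) h)
  have hUj : ∀ g, U g → g ^ 3 ^ (q + 1) = 1 → ∃ t ∈ T, t ^ 3 ^ (q + 1) = 1 ∧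
      ∃ c, C1 c ∧ g = t * c := by
    rintro _ ⟨l, t, ht, rfl⟩ h
    rw [← pow_mul, mul_comm, pow_mul] at h
    have ht' := pow_three_coprime (coprime_one_add hq) h
    exact ⟨t, ht, ht', _, (hd t ht').pow l, by rw [pow_add, pow_one, pow_mul]⟩
  have hUC : ∀ c, C1 c → ∀ g, U g → U (c * g) := by
    rintro c hc g hg
    obtain ⟨k, rfl⟩ := C1_pow hq (hUmin g hg) hc
    obtain ⟨l, t, ht, rfl⟩ := hg
    refine ⟨l + k + l * k * 3 ^ q, t, ht, ?_⟩
    rw [← pow_mul, ← pow_add]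
    congr 1
    ring
  have hUb : U b := ⟨0, b, hb, by simp⟩
  -- step 6
  set W : Dgrp n → Prop := fun w => ∀ g, U g → U (w * g) with hW
  have hW1 : W 1 := fun g hg => by simpa using hg
  have hWmul : ∀ x y, W x → W y → W (x * y) := fun x y hx hy g hg => by
    rw [mul_assoc]; exact hx _ (hy _ hg)
  have hWpow : ∀ x, W x → ∀ k : ℕ, W (x ^ k) := by
    intro x hx k
    induction k with
    | zero => simpa using hW1
    | succ k ih => rw [pow_succ]; exact hWmul _ _ ih hx
  have hWinv : ∀ x, W x → W x⁻¹ := by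
    intro x hx
    have : x⁻¹ = x ^ (3 ^ n * 3 - 1) := by
      rw [inv_eq_iff_mul_eq_one, ← pow_succ', Nat.sub_add_cancel, D_pow]
      have : 0 < 3 ^ n := by positivity
      omega
    rw [this]; exact hWpow x hx _
  have hWA : AS S W := by
    intro X hX x hx y hy hWx
    have h := hUA.count hS (hUA.inv hS) X hX x hx y hy
    have hx1 : (Finset.univ.filter (fun p => U p ∧ U (p⁻¹ * x)⁻¹)) = Finset.univ.filter U := by
      apply Finset.filter_congr
      intro p _
      constructor
      · exact fun h => h.1
      · intro hp
        refine ⟨hp, ?_⟩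
        have := hWinv x hWx p hp
        rwa [mul_inv_rev, inv_inv]
    rw [hx1] at h
    have hsub : (Finset.univ.filter (fun p => U p ∧ U (p⁻¹ * y)⁻¹)) ⊆ Finset.univ.filter U := by
      intro p hp
      simp only [Finset.mem_filter, Finset.mem_univ, true_and] at hp ⊢
      exact hp.1
    have heq := Finset.eq_of_subset_of_card_le hsub h.le
    have : W y⁻¹ := by
      intro p hp
      have hm : p ∈ Finset.univ.filter U := by simpa using hp
      rw [← heq] at hm
      have := (Finset.mem_filter.1 hm).2.2
      rwa [mul_inv_rev, inv_inv] at this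
    simpa using hWinv _ this
  have hWC : ∀ c, C1 c → W c := hUC
  have hWq : ∀ w, W w → w ^ 3 ^ q = 1 := by
    intro w hw
    by_contra h
    obtain ⟨l, hl⟩ := C1_pow hq h hc0C.inv
    apply hUmin _ (hWpow w hw l b hUb)
    rw [mul_pow, ← pow_mul, mul_comm l, ← hl, hc0, inv_mul_cancel]
  have hWq1 : ∀ w, W w → w ^ 3 ^ (q + 1) = 1 := by
    intro w hw; rw [pow_succ, pow_mul, hWq w hw, one_pow]
  have hWC1 : ∀ w, W w → w.1 = 1 → C1 w := by
    intro w hw hw1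
    obtain ⟨t, ht, ht', c, hc, e⟩ := hUj _ (hw b hUb) (by rw [mul_pow, hb', hWq1 w hw, one_mul])
    have ht2 : t = b * (w * c⁻¹) := by
      rw [← mul_assoc, mul_comm b w, e]; simp
    have hwc : W (w * c⁻¹) := hWmul _ _ hw (hWC _ hc.inv)
    have := h3 b hb hb' (w * c⁻¹) (by rw [Prod.fst_mul, hw1, hc.inv.1, one_mul])
      (hWq _ hwc) (by rw [← ht2]; exact ht)
    rw [mul_inv_eq_one.1 this]; exact hc
  -- step 7
  have hcount : ∀ V : Dgrp n → Prop, AS S V → ∀ x ∈ T, ∀ y ∈ T,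
      (T.filter (fun t => V (t⁻¹ * x))).card = (T.filter (fun t => V (t⁻¹ * y))).card := by
    intro V hV x hx y hy
    have := hTA.count hS hV T hT x hx y hy
    rw [← Finset.filter_filter, ← Finset.filter_filter] at this
    simpa using this
  set C : Finset (Dgrp n) := {1, c0, c0 ^ 2} with hC
  have hCmem : ∀ c, c ∈ C ↔ C1 c := by
    intro c
    simp only [hC, Finset.mem_insert, Finset.mem_singleton]
    constructor
    · rintro (rfl | rfl | rfl)
      exacts [C1.one, hc0C, hc0C.pow 2]
    · exact C1_gen3 hc0C hc01
  have hCcard : C.card = 3 := by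
    have h02 : c0 ^ 2 ≠ 1 := fun h => hc01 (pow_three_coprime (by norm_num) h)
    have h12 : c0 ≠ c0 ^ 2 := by
      intro h
      rw [pow_two] at h
      exact hc01 (by simpa using h)
    rw [hC, Finset.card_eq_three]
    exact ⟨1, c0, c0 ^ 2, hc01.symm, h02.symm, h12, rfl⟩
  have haC : ∀ x ∈ R, C.image (x * ·) ⊆ T := by
    intro x hx y hy
    obtain ⟨c, hc, rfl⟩ := Finset.mem_image.1 hy
    have hx := Finset.mem_filter.1 hx
    exact hR x hx.1 hx.2 c ((hCmem c).1 hc)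
  have hCimg : ∀ x, (C.image (x * ·)).card = 3 := by
    intro x
    rw [Finset.card_image_of_injective _ (mul_right_injective x), hCcard]
  have hr : (T.filter (fun t => W (t⁻¹ * b))).card ≤ 3 := by
    have h : (T.filter (fun t => W (t⁻¹ * b))).card ≤
        (Finset.univ : Finset (Multiplicative (ZMod 3))).card := by
      apply Finset.card_le_card_of_injOn (fun t => t.1)
      · intro t _; simp
      · intro t ht t' ht' h
        have ht := Finset.mem_filter.1 ht
        have ht' := Finset.mem_filter.1 ht'
        have hw : W (t⁻¹ * t') := by
          have := hWmul _ _ ht.2 (hWinv _ ht'.2)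
          simpa using this
        have h2 : t ^ 3 ^ (q + 1) = 1 := by
          have := hWq1 _ ht.2
          rw [mul_pow, hb', mul_one, inv_pow, inv_eq_one] at this
          exact this
        have hc : C1 (t⁻¹ * t') := hWC1 _ hw (by
          rw [Prod.fst_mul, Prod.fst_inv]; exact inv_mul_eq_one.2 h)
        exact inv_mul_eq_one.1 (hbad' t ht.1 h2 _ hc (by simpa using ht'.1))
    exact h
  have haW : ∀ x ∈ R, ∀ w, W w → x * w ∈ T → C1 w := by
    intro x hx w hw hxw
    have hxT := (Finset.mem_filter.1 hx).1
    have h := hcount W hWA x hxT b hb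
    have hsub : C.image (x * ·) ⊆ T.filter (fun t => W (t⁻¹ * x)) := by
      intro y hy
      refine Finset.mem_filter.2 ⟨haC x hx hy, ?_⟩
      obtain ⟨c, hc, rfl⟩ := Finset.mem_image.1 hy
      simpa using hWC _ ((hCmem c).1 hc).inv
    have heq := Finset.eq_of_subset_of_card_le hsub (by
      rw [hCimg]; refine le_trans (le_of_eq ?_) hr; convert h)
    have hm : x * w ∈ T.filter (fun t => W (t⁻¹ * x)) :=
      Finset.mem_filter.2 ⟨hxw, by simpa using hWinv w hw⟩
    rw [← heq] at hm
    obtain ⟨c, hc, e⟩ := Finset.mem_image.1 hm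
    rw [← mul_left_cancel e]
    exact (hCmem c).1 hc
  have haR : a ∈ R := Finset.mem_filter.2 ⟨ha, ha'⟩
  have hbT0 : b ∈ T0 := Finset.mem_filter.2 ⟨hb, hb'⟩
  -- step 8
  have hC1nA : ¬ AS S C1 := by
    intro h
    have e := hcount C1 h a ha b hb
    have h1 : (T.filter (fun t => C1 (t⁻¹ * b))).card ≤ 1 := by
      rw [Finset.card_le_one]
      have : ∀ t ∈ T.filter (fun t => C1 (t⁻¹ * b)), t = b := by
        intro t ht
        have ht := Finset.mem_filter.1 ht
        have h4 := hbad' b hb hb' _ ht.2.inv (by simpa using ht.1)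
        exact (show b = t by simpa [inv_mul_eq_one] using h4).symm
      intro x hx y hy
      rw [this x hx, this y hy]
    have h2 : 3 ≤ (T.filter (fun t => C1 (t⁻¹ * a))).card := by
      refine (hCimg a).symm.le.trans (Finset.card_le_card ?_)
      intro y hy
      refine Finset.mem_filter.2 ⟨haC a haR hy, ?_⟩
      obtain ⟨c, hc, rfl⟩ := Finset.mem_image.1 hy
      simpa using ((hCmem c).1 hc).inv
    omega
  set N : Dgrp n → ℕ := fun g => (T.filter (fun t => t * g ∈ T)).card with hN
  have hNconst : ∀ X ∈ S, ∀ x ∈ X, ∀ y ∈ X, N x = N y := by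
    intro X hX x hx y hy
    have h := (hTA.inv hS).count hS hTA X hX x hx y hy
    have e : ∀ x, N x = (Finset.univ.filter (fun p => p⁻¹ ∈ T ∧ p⁻¹ * x ∈ T)).card := by
      intro x
      refine Finset.card_bij (fun t _ => t⁻¹) ?_ ?_ ?_
      · intro t ht; simpa using ht
      · intro t _ t' _ h; exact inv_injective h
      · intro p hp; exact ⟨p⁻¹, by simpa using hp, by simp⟩
    rw [e, e]
    convert h
  have hNc : ∀ c, C1 c → c ≠ 1 → N c = R.card := by
    intro c hc hc1
    show (T.filter (fun t => t * c ∈ T)).card = R.card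
    rw [hRdef]
    refine congrArg _ (Finset.filter_congr ?_)
    intro t ht
    constructor
    · intro h h'
      exact hc1 (hbad' t ht h' c hc h)
    · intro h
      exact hR t ht h c hc
  have hN1 : N 1 ≠ R.card := by
    have : N 1 = T.card := by simp [hN]
    have : 0 < T0.card := Finset.card_pos.2 ⟨b, hbT0⟩
    omega
  have hex : ∃ g, W g ∧ N g = R.card ∧ ¬ C1 g := by
    by_contra hcon
    push Not at hcon
    apply hC1nA
    have e : ∀ g, C1 g ↔ (W g ∧ N g = R.card) ∨ g = 1 := by
      intro g
      constructor
      · intro hg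
        by_cases h1 : g = 1
        · exact Or.inr h1
        · exact Or.inl ⟨hWC g hg, hNc g hg h1⟩
      · rintro (h | rfl)
        · exact hcon g h.1 h.2
        · exact C1.one
    intro X hX x hx y hy h
    rw [e] at h ⊢
    rcases h with h | rfl
    · exact Or.inl ⟨hWA X hX x hx y hy h.1, by rw [← hNconst X hX x hx y hy, h.2]⟩
    · right
      have := AS.of_mem hS hS.one_mem X hX 1 hx y hy (by simp)
      simpa using this
  obtain ⟨g, hgW, hgN, hgC⟩ := hex
  have hRle : R.card ≤ T0.card := by
    rw [← hgN]
    apply Finset.card_le_card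
    intro t ht
    have ht := Finset.mem_filter.1 ht
    refine Finset.mem_filter.2 ⟨ht.1, ?_⟩
    by_contra h
    exact hgC (haW t (Finset.mem_filter.2 ⟨ht.1, h⟩) g hgW ht.2)
  -- step 9
  set V : Dgrp n → Prop := fun g => ∃ t ∈ T, W (t⁻¹ * g) with hV
  have hVA : AS S V := by
    rintro X hX x hx y hy ⟨t, ht, hw⟩
    have h := hTA.count hS hWA X hX x hx y hy
    have hpos : 0 < (Finset.univ.filter (fun p => p ∈ T ∧ W (p⁻¹ * x))).card :=
      Finset.card_pos.2 ⟨t, by simp [ht, hw]⟩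
    replace hpos := hpos.trans_eq
      (show _ = (Finset.univ.filter (fun p => p ∈ T ∧ W (p⁻¹ * y))).card by convert h)
    obtain ⟨p, hp⟩ := Finset.card_pos.1 hpos
    have hp := (Finset.mem_filter.1 hp).2
    exact ⟨p, hp.1, hp.2⟩
  have hVm : ∀ l : ℕ, PowS (1 + 3 ^ q * l) V a := by
    intro l
    apply hVA.pow hS _ (card_coprime (coprime_one_add hq)) T hT b hb a ha
    have hc : C1 (c0 ^ l) := hc0C.pow l
    refine ⟨b * (c0 ^ l)⁻¹, ⟨b, hb, by simpa using hWC _ hc.inv⟩, ?_⟩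
    rw [pow_add, pow_one, mul_pow, hc.inv.pow3 hq, mul_one, pow_mul, ← hc0]
    simp
  choose v hvV hva using hVm
  choose t ht htv using hvV
  have hvne : ∀ l, v l ^ 3 ^ (q + 1) ≠ 1 := by
    intro l h
    apply ha'
    rw [← hva l, ← pow_mul, mul_comm, pow_mul, h, one_pow]
  have htR : ∀ l, t l ∈ R := by
    intro l
    refine Finset.mem_filter.2 ⟨ht l, fun h => hvne l ?_⟩
    have := hWq1 _ (htv l)
    rwa [mul_pow, inv_pow, h, inv_one, one_mul] at this
  have hdist : ∀ l l' : ℕ, l < 3 → l' < 3 → W ((t l)⁻¹ * t l') → l = l' := by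
    intro l l' hl hl' hw
    have hw2 : W ((v l)⁻¹ * v l') := by
      have := hWmul _ _ (hWmul _ _ (hWinv _ (htv l)) hw) (htv l')
      simpa [mul_assoc] using this
    set w := (v l)⁻¹ * v l' with hwdef
    have hv' : v l' = v l * w := by rw [hwdef]; simp
    have e := hva l'
    rw [hv', mul_pow, ← hva l, pow_add (v l), pow_add (v l), mul_assoc,
      mul_right_inj, pow_mul (v l), pow_mul (v l)] at e
    set z := v l ^ 3 ^ q with hz
    have hz3 : z ^ 3 ≠ 1 := by
      rw [hz, ← pow_mul, ← pow_succ]; exact hvne l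
    have hw3 : W (w ^ (1 + 3 ^ q * l')) := hWpow _ hw2 _
    have hz1 : z.1 = 1 := fst_pow3 _ hq
    have hC' : C1 (w ^ (1 + 3 ^ q * l')) := by
      apply hWC1 _ hw3
      have := congrArg Prod.fst e
      rw [Prod.fst_mul, Prod.pow_fst z, Prod.pow_fst z, hz1, one_pow, one_pow, one_mul] at this
      exact this
    have e3 := congrArg (· ^ 3) e
    simp only [mul_pow, hC'.2, mul_one] at e3
    replace e3 : (z ^ 3) ^ l' = (z ^ 3) ^ l := by
      rw [pow_right_comm z 3 l', pow_right_comm z 3 l]; exact e3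
    clear_value z
    have hz32 : (z ^ 3) ^ 2 ≠ 1 := fun h => hz3 (pow_three_coprime (by norm_num) h)
    exact pow_lt_three_inj hz3 hz32 hl hl' e3.symm
  have hnine : 9 ≤ R.card := by
    have h : (Finset.range 3 ×ˢ C).card ≤ R.card := by
      apply Finset.card_le_card_of_injOn (fun p => t p.1 * p.2)
      · rintro ⟨l, c⟩ hp
        simp only [Finset.coe_product, Set.mem_prod, Finset.mem_coe] at hp
        have hc := (hCmem c).1 hp.2
        have h1 := Finset.mem_filter.1 (htR l)
        refine Finset.mem_coe.2 (Finset.mem_filter.2 ⟨hR _ h1.1 h1.2 c hc, ?_⟩)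
        rw [mul_pow, hWq1 _ (hWC c hc), mul_one]
        exact h1.2
      · rintro ⟨l, c⟩ hp ⟨l', c'⟩ hp' h
        simp only [Finset.coe_product, Set.mem_prod, Finset.mem_coe, Finset.mem_range] at hp hp'
        simp only at h
        have hc := (hCmem c).1 hp.2
        have hc' := (hCmem c').1 hp'.2
        have hl : l = l' := by
          apply hdist l l' hp.1 hp'.1
          have : (t l)⁻¹ * t l' = c * c'⁻¹ := by
            rw [inv_mul_eq_iff_eq_mul, ← mul_assoc, h, mul_inv_cancel_right]
          rw [this]
          exact hWC _ (hc.mul hc'.inv)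
        subst hl
        rw [mul_left_cancel h]
    rw [Finset.card_product, hCcard, Finset.card_range] at h
    exact h
  omega

end Main

/-- a nonregular basic set `T` of an S-ring over
`D = ℤ₃ × ℤ_{3^n}` containing no element of order 3 has nontrivial radical. -/
theorem stmt16 (n : ℕ) (hn : 2 ≤ n) (S : Finset (Finset (Dgrp n)))
    (hS : IsSRing S) (T : Finset (Dgrp n)) (hT : T ∈ S)
    (hnonreg : ∃ a ∈ T, ∃ b ∈ T, orderOf a ≠ orderOf b)
    (hno3 : ∀ t ∈ T, orderOf t ≠ 3) :
    ∃ g : Dgrp n, g ≠ 1 ∧ T.image (g * ·) = T ∧ T.image (· * g) = T := by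
  obtain ⟨b, hb, hbmin⟩ := Finset.exists_min_image T orderOf (hS.nonempty T hT)
  obtain ⟨j, hj⟩ := order_pow b
  have h1 : ∀ t ∈ T, t ≠ 1 := by
    rintro t ht rfl
    obtain ⟨x, hx, y, hy, hxy⟩ := hnonreg
    have e : ∀ z ∈ T, z = 1 := fun z hz => by
      simpa using AS.of_mem hS hS.one_mem T hT 1 ht z hz (by simp)
    exact hxy (by rw [e x hx, e y hy])
  obtain ⟨a, ha, hab⟩ : ∃ a ∈ T, orderOf a ≠ orderOf b := by
    obtain ⟨x, hx, y, hy, hxy⟩ := hnonreg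
    by_cases h : orderOf x = orderOf b
    · exact ⟨y, hy, fun h' => hxy (h.trans h'.symm)⟩
    · exact ⟨x, hx, h⟩
  have hj2 : 2 ≤ j := by
    by_contra hlt
    have : j = 0 ∨ j = 1 := by omega
    rcases this with rfl | rfl
    · exact h1 b hb (orderOf_eq_one_iff.1 (by simpa using hj))
    · exact hno3 b hb (by simpa using hj)
  obtain ⟨q, rfl⟩ : ∃ q, j = q + 1 := ⟨j - 1, by omega⟩
  obtain ⟨g, hg, h⟩ := main_core hS hT (q := q) (by omega) (fun t ht h => by
      have h2 := hbmin t ht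
      have h3 := Nat.le_of_dvd (by positivity) (orderOf_dvd_of_pow_eq_one h)
      have h4 : 3 ^ q < 3 ^ (q + 1) := Nat.pow_lt_pow_right (by norm_num) (by omega)
      omega) ha hb (by rw [← hj]; exact pow_orderOf_eq_one b) (fun h => by
      have h2 := hbmin a ha
      have h3 := Nat.le_of_dvd (by positivity) (orderOf_dvd_of_pow_eq_one h)
      omega)
  have hr : T.image (· * g) = T := by
    apply Finset.eq_of_subset_of_card_le
    · intro y hy
      obtain ⟨x, hx, rfl⟩ := Finset.mem_image.1 hy
      exact h x hx
    · rw [Finset.card_image_of_injective _ (mul_left_injective g)]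
  refine ⟨g, hg, ?_, hr⟩
  rw [← hr]
  conv_rhs => rw [← hr]
  simp only [mul_comm g]
end
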